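/- There exists a universal constant c > 0 with the following property. Let n ≥ 2, let ρ : ℝⁿ → ℝ be smooth and convex, let μ be the probability measure on ℝⁿ with density e^{−ρ} with respect to Lebesgue measure, and let R > 0 be such that every 1-Lipschitz function u : ℝⁿ → ℝ satisfies inf_{α∈ℝ} ∫_{ℝⁿ} |u(x) − α| dμ(x) < R. Then for every Borel set S ⊆ ℝⁿ and every ε with 0 < ε < R, μ(S_ε \ S) ≥ c·(ε/R)·μ(S)·(1 − μ(S)), where S_ε = { x ∈ ℝⁿ : dist(x,S) < ε } is the open ε-neighborhood of S. (Buser–Ledoux–E. Milman inequality, Euclidean case.) -/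

import Mathlib

open MeasureTheory
open scoped ENNReal

namespace BLM
open MeasureTheory ProbabilityTheory
open scoped ENNReal

set_option linter.unusedSectionVars false
set_option linter.unusedVariables false

variable {E : Type*} [NormedAddCommGroup E] [InnerProductSpace ℝ E] [FiniteDimensional ℝ E]
  [MeasurableSpace E] [BorelSpace E]

lemma g_int_pow (k : ℕ) : Integrable (fun g : E => ‖g‖ ^ k) (stdGaussian E) := by
  have h := IsGaussian.memLp_id (stdGaussian E) (k : ℝ≥0∞) (by simp)
  exact h.integrable_norm_pow'

lemma g_int_norm : Integrable (fun g : E => ‖g‖) (stdGaussian E) := by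
  simpa using g_int_pow (E := E) 1

lemma g_int_inner (v : E) : Integrable (fun g : E => inner ℝ v g) (stdGaussian E) := by
  refine Integrable.mono' (g_int_norm.const_mul ‖v‖) (by fun_prop) (.of_forall fun g => ?_)
  exact norm_inner_le_norm v g

lemma g_mean (v : E) : ∫ g : E, inner ℝ v g ∂(stdGaussian E) = 0 := by
  have := integral_strongDual_stdGaussian (E := E) (innerSL ℝ v)
  simpa using this

lemma g_inner (u v : E) : ∫ g : E, inner ℝ u g * inner ℝ v g ∂(stdGaussian E) = inner ℝ u v := by
  have h := covarianceBilin_stdGaussian (E := E)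
  have h2 := covarianceBilin_apply (μ := stdGaussian E) IsGaussian.memLp_two_id u v
  rw [h] at h2
  simp at h2
  exact h2.symm

lemma rot_integral {F : Type*} [NormedAddCommGroup F] [NormedSpace ℝ F] (θ : ℝ) (f : E × E → F)
    (hf : Continuous f) :
    ∫ z : E × E, f (Real.cos θ • z.1 + Real.sin θ • z.2, -Real.sin θ • z.1 + Real.cos θ • z.2)
      ∂((stdGaussian E).prod (stdGaussian E)) = ∫ z, f z ∂((stdGaussian E).prod (stdGaussian E)) := by
  have h := IsGaussian.map_rotation_eq_self (μ := stdGaussian E) (by simp) θ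
  conv_rhs => rw [← h]
  rw [integral_map (by fun_prop) (by fun_prop)]
  rfl

structure Good (Λ : ℝ) (F : E → ℝ) : Prop where
  cd : ContDiff ℝ 1 F
  lip : ∀ x, ‖fderiv ℝ F x‖ ≤ Λ
  bdd : ∃ C, ∀ x, |F x| ≤ C

lemma Good.nonneg {Λ : ℝ} {F : E → ℝ} (h : Good Λ F) : 0 ≤ Λ := (norm_nonneg _).trans (h.lip 0)

lemma Good.cont {Λ : ℝ} {F : E → ℝ} (h : Good Λ F) : Continuous F := h.cd.continuous

lemma Good.diff {Λ : ℝ} {F : E → ℝ} (h : Good Λ F) : Differentiable ℝ F :=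
  h.cd.differentiable (by norm_num)

lemma Good.hasFDeriv {Λ : ℝ} {F : E → ℝ} (h : Good Λ F) (x : E) :
    HasFDerivAt F (fderiv ℝ F x) x := (h.diff x).hasFDerivAt

lemma Good.contD {Λ : ℝ} {F : E → ℝ} (h : Good Λ F) : Continuous (fderiv ℝ F) :=
  h.cd.continuous_fderiv (by norm_num)

lemma Good.dist {Λ : ℝ} {F : E → ℝ} (h : Good Λ F) (x y : E) : |F x - F y| ≤ Λ * ‖x - y‖ := by
  have := Convex.norm_image_sub_le_of_norm_fderiv_le (𝕜 := ℝ) (f := F) (s := Set.univ)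
    (fun x _ => h.diff x) (fun x _ => h.lip x) convex_univ (Set.mem_univ y) (Set.mem_univ x)
  simpa using this

lemma fderiv_apply_le {Λ : ℝ} {F : E → ℝ} (h : Good Λ F) (x v : E) :
    |fderiv ℝ F x v| ≤ Λ * ‖v‖ :=
  (ContinuousLinearMap.le_opNorm _ _).trans (mul_le_mul_of_nonneg_right (h.lip x) (norm_nonneg v))

lemma prod_int_sq : Integrable (fun z : E × E => (1 + ‖z.1‖ + ‖z.2‖) ^ 2)
    ((stdGaussian E).prod (stdGaussian E)) := by
  have h1 := g_int_norm (E := E)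
  have h2 := g_int_pow (E := E) 2
  have a1 := h1.comp_fst (stdGaussian E)
  have a2 := h1.comp_snd (stdGaussian E)
  have b1 := h2.comp_fst (stdGaussian E)
  have b2 := h2.comp_snd (stdGaussian E)
  have c := h1.mul_prod h1
  refine ((((((integrable_const (1:ℝ)).add b1).add b2).add (a1.const_mul 2)).add
    (a2.const_mul 2)).add (c.const_mul 2)).congr (.of_forall fun z => ?_)
  simp only [Pi.add_apply]
  ring

lemma rot_norm_le (θ : ℝ) (a b : E) : ‖Real.cos θ • a + Real.sin θ • b‖ ≤ ‖a‖ + ‖b‖ := by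
  refine (norm_add_le _ _).trans ?_
  rw [norm_smul, norm_smul]
  have h1 := Real.abs_cos_le_one θ
  have h2 := Real.abs_sin_le_one θ
  simp only [Real.norm_eq_abs]
  nlinarith [norm_nonneg a, norm_nonneg b]

lemma rot_norm_le' (θ : ℝ) (a b : E) : ‖-Real.sin θ • a + Real.cos θ • b‖ ≤ ‖a‖ + ‖b‖ := by
  refine (norm_add_le _ _).trans ?_
  rw [norm_smul, norm_smul]
  have h1 := Real.abs_cos_le_one θ
  have h2 := Real.abs_sin_le_one θ
  simp only [Real.norm_eq_abs, abs_neg]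
  nlinarith [norm_nonneg a, norm_nonneg b]

lemma hasDeriv_rot (θ : ℝ) (a b : E) : HasDerivAt (fun t : ℝ => Real.cos t • a + Real.sin t • b)
    (-Real.sin θ • a + Real.cos θ • b) θ :=
  ((Real.hasDerivAt_cos θ).smul_const a).add ((Real.hasDerivAt_sin θ).smul_const b)

lemma hasDeriv_rot' (θ : ℝ) (a b : E) : HasDerivAt (fun t : ℝ => -Real.sin t • a + Real.cos t • b)
    (-(Real.cos θ • a + Real.sin θ • b)) θ := by
  refine (((Real.hasDerivAt_sin θ).neg.smul_const a).add
    ((Real.hasDerivAt_cos θ).smul_const b)).congr_deriv ?_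
  module

lemma stein0 {Λ : ℝ} {h : E → ℝ} (hh : Good Λ h) (v : E) :
    ∫ g, h g * inner ℝ v g ∂(stdGaussian E) = ∫ g, fderiv ℝ h g v ∂(stdGaussian E) := by
  obtain ⟨C, hC⟩ := hh.bdd
  have hC0 : 0 ≤ C := (abs_nonneg _).trans (hC 0)
  have hΛ := hh.nonneg
  have hcont := hh.cont
  have hcD := hh.contD
  set γ := stdGaussian E
  set m := γ.prod γ
  let X : ℝ → E × E → E := fun t z => Real.cos t • z.1 + Real.sin t • z.2
  let Y : ℝ → E × E → E := fun t z => -Real.sin t • z.1 + Real.cos t • z.2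
  let J : ℝ → E × E → ℝ := fun t z => h (X t z) * inner ℝ v (Y t z)
  let J' : ℝ → E × E → ℝ := fun t z => fderiv ℝ h (X t z) (Y t z) * inner ℝ v (Y t z)
    + h (X t z) * inner ℝ v (-(X t z))
  have hXc : ∀ t, Continuous (X t) := fun t => by fun_prop
  have hYc : ∀ t, Continuous (Y t) := fun t => by fun_prop
  have hX : ∀ t z, ‖X t z‖ ≤ 1 + ‖z.1‖ + ‖z.2‖ := fun t z => by
    have := rot_norm_le t z.1 z.2; simp only [X]; linarith
  have hY : ∀ t z, ‖Y t z‖ ≤ 1 + ‖z.1‖ + ‖z.2‖ := fun t z => by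
    have := rot_norm_le' t z.1 z.2; simp only [Y]; linarith
  have key := hasDerivAt_integral_of_dominated_loc_of_deriv_le (μ := m) (F := J) (F' := J')
    (x₀ := 0) (s := Set.univ) (bound := fun z => ((Λ + C) * ‖v‖) * (1 + ‖z.1‖ + ‖z.2‖) ^ 2)
    Filter.univ_mem (.of_forall fun t => (by fun_prop)) ?_ (by fun_prop) ?_
    (prod_int_sq.const_mul _) ?_
  · have hconst : ∀ t, ∫ z, J t z ∂m = ∫ z : E × E, h z.1 * inner ℝ v z.2 ∂m := fun t =>
      rot_integral t (fun z : E × E => h z.1 * inner ℝ v z.2) (by fun_prop)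
    have h0 : ∫ z, J' 0 z ∂m = 0 := by
      have h1 := key.2
      simp only [hconst] at h1
      exact h1.unique (hasDerivAt_const _ _)
    have e1 : ∀ z, J' 0 z = fderiv ℝ h z.1 z.2 * inner ℝ v z.2 - h z.1 * inner ℝ v z.1 := by
      intro z; simp [J', X, Y, inner_neg_right]; ring
    simp only [e1] at h0
    have i2 : Integrable (fun z : E × E => h z.1 * inner ℝ v z.1) m := by
      refine Integrable.comp_fst (f := fun g => h g * inner ℝ v g) ?_ γ
      refine (g_int_inner v).bdd_mul (c := C) (by fun_prop) (.of_forall hC)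
    have i1 : Integrable (fun z : E × E => fderiv ℝ h z.1 z.2 * inner ℝ v z.2) m := by
      have h1 := key.1
      rw [show J' 0 = _ from funext e1] at h1
      exact (h1.add i2).congr (.of_forall fun z => by simp)
    rw [integral_sub i1 i2, sub_eq_zero] at h0
    have e2 : ∫ z : E × E, h z.1 * inner ℝ v z.1 ∂m = ∫ g, h g * inner ℝ v g ∂γ := by
      have := integral_fun_fst (μ := γ) (ν := γ) (f := fun g => h g * inner ℝ v g)
      simpa using this
    rw [e2] at h0
    rw [← h0, integral_prod _ i1]
    refine integral_congr_ae (.of_forall fun x => ?_)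
    have h3 := g_inner ((InnerProductSpace.toDual ℝ E).symm (fderiv ℝ h x)) v
    simp only [InnerProductSpace.toDual_symm_apply] at h3
    exact h3
  · refine Integrable.mono' (prod_int_sq.const_mul (C * ‖v‖)) (by fun_prop) (.of_forall fun z => ?_)
    have h1 := hC (X 0 z)
    have h2 := norm_inner_le_norm (𝕜 := ℝ) v (Y 0 z)
    have h3 := hY 0 z
    have h4 : 1 ≤ 1 + ‖z.1‖ + ‖z.2‖ := by linarith [norm_nonneg z.1, norm_nonneg z.2]
    calc ‖J 0 z‖ = |h (X 0 z)| * ‖inner ℝ v (Y 0 z)‖ := norm_mul _ _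
      _ ≤ C * (‖v‖ * (1 + ‖z.1‖ + ‖z.2‖)) := by
        gcongr; exact h2.trans (by gcongr)
      _ ≤ _ := by
        rw [mul_assoc]; gcongr; nlinarith
  · refine .of_forall fun z t _ => ?_
    have h1 := hC (X t z)
    have h2 := norm_inner_le_norm (𝕜 := ℝ) v (Y t z)
    have h2' := norm_inner_le_norm (𝕜 := ℝ) v (-X t z)
    rw [norm_neg] at h2'
    have h3 := hY t z
    have h3' := hX t z
    have h5 := fderiv_apply_le hh (X t z) (Y t z)
    have h4 : 1 ≤ 1 + ‖z.1‖ + ‖z.2‖ := by linarith [norm_nonneg z.1, norm_nonneg z.2]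
    set r := 1 + ‖z.1‖ + ‖z.2‖
    calc ‖J' t z‖ ≤ |fderiv ℝ h (X t z) (Y t z)| * ‖inner ℝ v (Y t z)‖
          + |h (X t z)| * ‖inner ℝ v (-X t z)‖ := by
          refine (norm_add_le _ _).trans ?_
          rw [norm_mul, norm_mul]; rfl
      _ ≤ (Λ * r) * (‖v‖ * r) + C * (‖v‖ * r) := by
        gcongr
        · exact h5.trans (by gcongr)
        · exact h2.trans (by gcongr)
        · exact h2'.trans (by gcongr)
      _ ≤ _ := by
        have : C * (‖v‖ * r) * 1 ≤ C * (‖v‖ * r) * r := by gcongr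
        nlinarith
  · refine .of_forall fun z t _ => ?_
    have h1 : HasDerivAt (fun t => X t z) (Y t z) t := hasDeriv_rot t z.1 z.2
    have h2 : HasDerivAt (fun t => Y t z) (-(X t z)) t := hasDeriv_rot' t z.1 z.2
    have h3 := (hh.hasFDeriv (X t z)).comp_hasDerivAt t h1
    have h4 := ((innerSL ℝ v).hasFDerivAt (x := Y t z)).comp_hasDerivAt t h2
    refine (h3.mul h4).congr_deriv ?_
    simp [J', Function.comp_def]

end BLM

namespace BLM
open MeasureTheory ProbabilityTheory
open scoped ENNReal
set_option linter.unusedSectionVars false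
set_option linter.unusedVariables false

variable {E : Type*} [NormedAddCommGroup E] [InnerProductSpace ℝ E] [FiniteDimensional ℝ E]
  [MeasurableSpace E] [BorelSpace E]

lemma Good.int {Λ : ℝ} {h : E → ℝ} (hh : Good Λ h) (μ : Measure E) [IsFiniteMeasure μ] :
    Integrable h μ := by
  obtain ⟨C, hC⟩ := hh.bdd
  exact Integrable.of_bound hh.cont.aestronglyMeasurable C (.of_forall hC)

lemma Good.intD {Λ : ℝ} {h : E → ℝ} (hh : Good Λ h) (μ : Measure E) [IsFiniteMeasure μ] :
    Integrable (fderiv ℝ h) μ := by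
  exact Integrable.of_bound hh.contD.aestronglyMeasurable Λ (.of_forall hh.lip)

lemma Good.mul {Λ Λ' a b : ℝ} {f h : E → ℝ} (hf : Good Λ f) (hh : Good Λ' h)
    (ha : ∀ x, |f x| ≤ a) (hb : ∀ x, |h x| ≤ b) :
    Good (a * Λ' + b * Λ) (fun x => f x * h x) := by
  refine ⟨hf.cd.mul hh.cd, fun x => ?_, a * b, fun x => ?_⟩
  · have ha0 : 0 ≤ a := (abs_nonneg _).trans (ha 0)
    have hb0 : 0 ≤ b := (abs_nonneg _).trans (hb 0)
    rw [((hf.hasFDeriv x).fun_mul (hh.hasFDeriv x)).fderiv]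
    refine (norm_add_le _ _).trans ?_
    rw [norm_smul, norm_smul]
    have := ha x
    have := hb x
    have := hf.lip x
    have := hh.lip x
    simp only [Real.norm_eq_abs]
    gcongr
  · have ha0 : 0 ≤ a := (abs_nonneg _).trans (ha 0)
    rw [abs_mul]
    have := ha x
    have := hb x
    gcongr

lemma Good.shift {Λ σ : ℝ} {h : E → ℝ} (hh : Good Λ h) (hσ : 0 ≤ σ) (y : E) :
    Good (σ * Λ) (fun g => h (y + σ • g)) ∧
      ∀ g, fderiv ℝ (fun g => h (y + σ • g)) g = σ • fderiv ℝ h (y + σ • g) := by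
  have key : ∀ g, fderiv ℝ (fun g => h (y + σ • g)) g = σ • fderiv ℝ h (y + σ • g) := by
    intro g
    have h1 : HasFDerivAt (fun g : E => y + σ • g) (σ • ContinuousLinearMap.id ℝ E) g :=
      ((hasFDerivAt_id g).const_smul σ).const_add y
    have := ((hh.hasFDeriv (y + σ • g)).comp g h1).fderiv
    rw [Function.comp_def] at this
    rw [this]; ext v; simp
  refine ⟨⟨hh.cd.comp (by fun_prop), fun x => ?_, ?_⟩, key⟩
  · rw [key, norm_smul, Real.norm_eq_abs, abs_of_nonneg hσ]
    have := hh.lip (y + σ • x)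
    gcongr
  · obtain ⟨C, hC⟩ := hh.bdd
    exact ⟨C, fun x => hC _⟩

lemma stein {Λ σ : ℝ} {h : E → ℝ} (hh : Good Λ h) (hσ : 0 ≤ σ) (y v : E) :
    ∫ g, h (y + σ • g) * inner ℝ v g ∂(stdGaussian E)
      = σ * ∫ g, fderiv ℝ h (y + σ • g) v ∂(stdGaussian E) := by
  obtain ⟨h1, h2⟩ := hh.shift hσ y
  rw [stein0 h1 v]
  simp_rw [h2]
  rw [← integral_const_mul]
  rfl

lemma var_eq {μ : Measure E} [IsProbabilityMeasure μ] {Λ : ℝ} {h : E → ℝ} (hh : Good Λ h) (m : ℝ) :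
    ∫ g, (h g - m) ^ 2 ∂μ = ∫ g, h g ^ 2 ∂μ - 2 * m * ∫ g, h g ∂μ + m ^ 2 := by
  obtain ⟨C, hC⟩ := hh.bdd
  have i1 := hh.int μ
  have i2 : Integrable (fun g => h g ^ 2) μ := by
    refine ((hh.mul hh hC hC).int μ).congr (.of_forall fun x => by ring)
  have : ∀ g, (h g - m) ^ 2 = h g ^ 2 - 2 * m * h g + m ^ 2 := fun g => by ring
  simp_rw [this]
  rw [integral_add (i2.sub' (i1.const_mul _)) (integrable_const _), integral_sub i2 (i1.const_mul _),
    integral_const_mul]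
  simp

lemma N2_0 {Λ : ℝ} {h : E → ℝ} (hh : Good Λ h) :
    ‖∫ g, fderiv ℝ h g ∂(stdGaussian E)‖ ^ 2
      ≤ ∫ g, h g ^ 2 ∂(stdGaussian E) - (∫ g, h g ∂(stdGaussian E)) ^ 2 := by
  set γ := stdGaussian E
  obtain ⟨C, hC⟩ := hh.bdd
  set v := (InnerProductSpace.toDual ℝ E).symm (∫ g, fderiv ℝ h g ∂γ) with hv
  have hvn : ‖∫ g, fderiv ℝ h g ∂γ‖ = ‖v‖ := by rw [hv, LinearIsometryEquiv.norm_map]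
  rw [hvn]
  set m := ∫ g, h g ∂γ
  have e1 : ∫ g, h g * inner ℝ v g ∂γ = ‖v‖ ^ 2 := by
    rw [stein0 hh v, ← ContinuousLinearMap.integral_apply (hh.intD γ) v, ← real_inner_self_eq_norm_sq]
    conv_rhs => rw [hv, InnerProductSpace.toDual_symm_apply]
  have i1 := hh.int γ
  have i2 : Integrable (fun g => h g ^ 2) γ :=
    ((hh.mul hh hC hC).int γ).congr (.of_forall fun x => by ring)
  have i3 : Integrable (fun g => h g * inner ℝ v g) γ :=
    (g_int_inner v).bdd_mul (c := C) (by have := hh.cont; fun_prop) (.of_forall hC)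
  have i4 := g_int_inner v
  have i5 : Integrable (fun g : E => inner ℝ v g * inner ℝ v g) γ := by
    refine Integrable.mono' ((g_int_pow 2).const_mul (‖v‖ ^ 2)) (by fun_prop) (.of_forall fun g => ?_)
    have := norm_inner_le_norm (𝕜 := ℝ) v g
    rw [norm_mul, ← mul_pow, ← sq]
    gcongr
  have p : 0 ≤ ∫ g, (h g - m - inner ℝ v g) ^ 2 ∂γ := integral_nonneg fun g => sq_nonneg _
  have : ∀ g, (h g - m - inner ℝ v g) ^ 2 = (h g - m) ^ 2 - 2 * (h g * inner ℝ v g)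
    + (2 * m) * inner ℝ v g + inner ℝ v g * inner ℝ v g := fun g => by ring
  simp_rw [this] at p
  have i6 : Integrable (fun g => (h g - m) ^ 2) γ :=
    ((i2.sub (i1.const_mul (2 * m))).add (integrable_const (m ^ 2))).congr
      (.of_forall fun x => by simp; ring)
  rw [integral_add ((i6.sub' (i3.const_mul _)).fun_add (i4.const_mul _)) i5,
    integral_add (i6.sub' (i3.const_mul _)) (i4.const_mul _), integral_sub i6 (i3.const_mul _),
    integral_const_mul, integral_const_mul, e1, g_mean, g_inner, real_inner_self_eq_norm_sq,
    var_eq hh m] at p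
  change _ ≤ _ - m ^ 2
  have hm : ∫ g, h g ∂γ = m := rfl
  rw [hm] at p
  nlinarith

lemma cs_interval {L : ℝ} (hL : 0 < L) {φ : ℝ → ℝ} (hφ : Continuous φ) :
    (∫ t in (0:ℝ)..L, φ t) ^ 2 ≤ L * ∫ t in (0:ℝ)..L, φ t ^ 2 := by
  set I := ∫ t in (0:ℝ)..L, φ t with hI
  have p : 0 ≤ ∫ t in (0:ℝ)..L, (L * φ t - I) ^ 2 :=
    intervalIntegral.integral_nonneg hL.le fun t _ => sq_nonneg _
  have : ∀ t, (L * φ t - I) ^ 2 = L ^ 2 * φ t ^ 2 - (2 * L * I) * φ t + I ^ 2 := fun t => by ring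
  simp_rw [this] at p
  rw [intervalIntegral.integral_add, intervalIntegral.integral_sub,
    intervalIntegral.integral_const_mul, intervalIntegral.integral_const_mul, ← hI,
    intervalIntegral.integral_const] at p
  · simp only [sub_zero, smul_eq_mul] at p
    have : 0 ≤ L * (L * (∫ t in (0:ℝ)..L, φ t ^ 2) - I ^ 2) := by nlinarith
    have := nonneg_of_mul_nonneg_right this hL
    linarith
  all_goals exact Continuous.intervalIntegrable (by fun_prop) _ _

lemma N1_0 {Λ : ℝ} {h : E → ℝ} (hh : Good Λ h) :
    ∫ g, h g ^ 2 ∂(stdGaussian E) - (∫ g, h g ∂(stdGaussian E)) ^ 2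
      ≤ Real.pi ^ 2 / 8 * ∫ g, ‖fderiv ℝ h g‖ ^ 2 ∂(stdGaussian E) := by
  obtain ⟨C, hC⟩ := hh.bdd
  have hΛ := hh.nonneg
  have hcont := hh.cont
  have hcD := hh.contD
  have hπ : 0 < Real.pi / 2 := by positivity
  set γ := stdGaussian E
  set m := γ.prod γ with hm
  let X : ℝ → E × E → E := fun t z => Real.cos t • z.1 + Real.sin t • z.2
  let Y : ℝ → E × E → E := fun t z => -Real.sin t • z.1 + Real.cos t • z.2
  let φ : ℝ → E × E → ℝ := fun t z => fderiv ℝ h (X t z) (Y t z)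
  have hφc : Continuous (fun p : ℝ × (E × E) => φ p.1 p.2) := by fun_prop
  have ftc : ∀ z, ∫ t in (0:ℝ)..(Real.pi / 2), φ t z = h z.2 - h z.1 := by
    intro z
    have := intervalIntegral.integral_eq_sub_of_hasDerivAt (a := 0) (b := Real.pi / 2)
      (f := fun t => h (X t z)) (f' := fun t => φ t z)
      (fun t _ => (hh.hasFDeriv (X t z)).comp_hasDerivAt t (hasDeriv_rot t z.1 z.2))
      (Continuous.intervalIntegrable (by fun_prop) _ _)
    rw [this]; simp [X]
  have pw : ∀ z, (h z.2 - h z.1) ^ 2 ≤ Real.pi / 2 * ∫ t in (0:ℝ)..(Real.pi / 2), φ t z ^ 2 := by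
    intro z; rw [← ftc]; exact cs_interval hπ (by fun_prop)
  have i1 := hh.int γ
  have i2 : Integrable (fun g => h g ^ 2) γ :=
    ((hh.mul hh hC hC).int γ).congr (.of_forall fun x => by ring)
  have hbd : ∀ t z, ‖φ t z ^ 2‖ ≤ Λ ^ 2 * (1 + ‖z.1‖ + ‖z.2‖) ^ 2 := by
    intro t z
    have h1 := fderiv_apply_le hh (X t z) (Y t z)
    have h2 := rot_norm_le' t z.1 z.2
    have h3 : |φ t z| ≤ Λ * (1 + ‖z.1‖ + ‖z.2‖) := h1.trans (by gcongr; linarith)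
    rw [norm_pow, ← mul_pow]
    gcongr
    exact h3
  have iprod : Integrable (Function.uncurry fun z t => φ t z ^ 2)
      (m.prod (volume.restrict (Set.Ioc 0 (Real.pi / 2)))) := by
    refine Integrable.mono' ((prod_int_sq.const_mul (Λ ^ 2)).comp_fst _)
      (Continuous.aestronglyMeasurable ?_) (.of_forall fun p => hbd p.2 p.1)
    have : Continuous (fun p : (E × E) × ℝ => (φ p.2 p.1) ^ 2) := by fun_prop
    exact this
  have lhs : ∫ z : E × E, (h z.2 - h z.1) ^ 2 ∂m = 2 * (∫ g, h g ^ 2 ∂γ - (∫ g, h g ∂γ) ^ 2) := by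
    have : ∀ z : E × E, (h z.2 - h z.1) ^ 2 = h z.2 ^ 2 + h z.1 ^ 2 - 2 * (h z.1 * h z.2) :=
      fun z => by ring
    simp_rw [this]
    rw [integral_sub ((i2.comp_snd γ).fun_add (i2.comp_fst γ)) ((i1.mul_prod i1).const_mul 2),
      integral_add (i2.comp_snd γ) (i2.comp_fst γ), integral_const_mul,
      integral_prod_mul]
    have a1 := integral_fun_fst (μ := γ) (ν := γ) (f := fun g => h g ^ 2)
    have a2 := integral_fun_snd (μ := γ) (ν := γ) (f := fun g => h g ^ 2)
    rw [a1, a2]; simp; ring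
  have rhs : ∀ t, ∫ z, φ t z ^ 2 ∂m = ∫ g, ‖fderiv ℝ h g‖ ^ 2 ∂γ := by
    intro t
    have e := rot_integral t (fun z : E × E => (fderiv ℝ h z.1 z.2) ^ 2) (by fun_prop)
    have i0 : Integrable (fun z : E × E => (fderiv ℝ h z.1 z.2) ^ 2) m := by
      refine Integrable.mono' (prod_int_sq.const_mul (Λ ^ 2)) (by fun_prop) (.of_forall fun z => ?_)
      have := hbd 0 z
      simpa [φ, X, Y] using this
    refine e.trans ?_
    rw [integral_prod _ i0]
    refine integral_congr_ae (.of_forall fun x => ?_)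
    have h3 := g_inner ((InnerProductSpace.toDual ℝ E).symm (fderiv ℝ h x))
      ((InnerProductSpace.toDual ℝ E).symm (fderiv ℝ h x))
    rw [real_inner_self_eq_norm_sq, LinearIsometryEquiv.norm_map] at h3
    simp only [InnerProductSpace.toDual_symm_apply, ← sq] at h3
    exact h3
  have main : ∫ z : E × E, (h z.2 - h z.1) ^ 2 ∂m
      ≤ ∫ z, Real.pi / 2 * (∫ t in (0:ℝ)..(Real.pi / 2), φ t z ^ 2) ∂m := by
    refine integral_mono_of_nonneg (.of_forall fun z => sq_nonneg _) ?_ (.of_forall pw)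
    refine Integrable.const_mul ?_ _
    have := iprod.integral_prod_left
    refine this.congr (.of_forall fun z => ?_)
    simp only [Function.uncurry]
    rw [intervalIntegral.integral_of_le hπ.le]
  rw [lhs, integral_const_mul] at main
  have sw : ∫ z, (∫ t in (0:ℝ)..(Real.pi / 2), φ t z ^ 2) ∂m
      = Real.pi / 2 * ∫ g, ‖fderiv ℝ h g‖ ^ 2 ∂γ := by
    simp_rw [intervalIntegral.integral_of_le hπ.le]
    rw [integral_integral_swap iprod]
    simp_rw [rhs]
    simp [hπ.le]
  rw [sw] at main
  nlinarith

lemma N2 {Λ σ : ℝ} {h : E → ℝ} (hh : Good Λ h) (hσ : 0 ≤ σ) (y : E) :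
    σ ^ 2 * ‖∫ g, fderiv ℝ h (y + σ • g) ∂(stdGaussian E)‖ ^ 2
      ≤ ∫ g, h (y + σ • g) ^ 2 ∂(stdGaussian E) - (∫ g, h (y + σ • g) ∂(stdGaussian E)) ^ 2 := by
  obtain ⟨h1, h2⟩ := hh.shift hσ y
  have := N2_0 h1
  simp_rw [h2, integral_smul, norm_smul, mul_pow] at this
  simpa using this

lemma N1 {Λ σ : ℝ} {h : E → ℝ} (hh : Good Λ h) (hσ : 0 ≤ σ) (y : E) :
    ∫ g, h (y + σ • g) ^ 2 ∂(stdGaussian E) - (∫ g, h (y + σ • g) ∂(stdGaussian E)) ^ 2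
     ≤ Real.pi ^ 2 / 8 * σ ^ 2 * ∫ g, ‖fderiv ℝ h (y + σ • g)‖ ^ 2 ∂(stdGaussian E) := by
  obtain ⟨h1, h2⟩ := hh.shift hσ y
  have := N1_0 h1
  simp_rw [h2, norm_smul, mul_pow, integral_const_mul] at this
  simpa [mul_assoc] using this

end BLM

namespace BLM
open MeasureTheory ProbabilityTheory
open scoped ENNReal
set_option linter.unusedSectionVars false
set_option linter.unusedVariables false

variable {E : Type*} [NormedAddCommGroup E] [InnerProductSpace ℝ E] [FiniteDimensional ℝ E]
  [MeasurableSpace E] [BorelSpace E]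

noncomputable def Hs (σ : ℝ) (F : E → ℝ) (x : E) : ℝ := ∫ g, F (x + σ • g) ∂(stdGaussian E)

lemma Good.int_shift {Λ σ : ℝ} {F : E → ℝ} (hF : Good Λ F) (x : E) :
    Integrable (fun g => F (x + σ • g)) (stdGaussian E) := by
  obtain ⟨C, hC⟩ := hF.bdd
  have := hF.cont
  exact Integrable.of_bound (by fun_prop) C (.of_forall fun g => hC _)

lemma Good.intD_shift {Λ σ : ℝ} {F : E → ℝ} (hF : Good Λ F) (x : E) :
    Integrable (fun g => fderiv ℝ F (x + σ • g)) (stdGaussian E) := by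
  have := hF.contD
  exact Integrable.of_bound (by fun_prop) Λ (.of_forall fun g => hF.lip _)

lemma Hs_hasFDeriv {Λ σ : ℝ} {F : E → ℝ} (hF : Good Λ F) (x : E) :
    HasFDerivAt (Hs σ F) (∫ g, fderiv ℝ F (x + σ • g) ∂(stdGaussian E)) x := by
  have hc := hF.cont
  have hcD := hF.contD
  refine hasFDerivAt_integral_of_dominated_of_fderiv_le (s := Set.univ) (bound := fun _ => Λ)
    (F := fun x g => F (x + σ • g)) (F' := fun x g => fderiv ℝ F (x + σ • g))
    Filter.univ_mem (.of_forall fun y => ?_) (hF.int_shift x) ?_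
    (.of_forall fun g y _ => hF.lip _) (integrable_const _) (.of_forall fun g y _ => ?_)
  · fun_prop
  · fun_prop
  · have := (hF.hasFDeriv (y + σ • g)).comp y ((hasFDerivAt_id y).add_const (σ • g))
    simpa [Function.comp_def] using this

lemma Hs_bdd {σ C : ℝ} {F : E → ℝ} (hC : ∀ x, |F x| ≤ C) (x : E) : |Hs σ F x| ≤ C := by
  have := norm_integral_le_of_norm_le_const (μ := stdGaussian E) (f := fun g => F (x + σ • g)) (C := C)
    (.of_forall fun g => hC _)
  simpa [Hs] using this

lemma Hs_good {Λ σ : ℝ} {F : E → ℝ} (hF : Good Λ F) : Good Λ (Hs σ F) := by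
  have hfd : fderiv ℝ (Hs σ F) = fun x => ∫ g, fderiv ℝ F (x + σ • g) ∂(stdGaussian E) :=
    funext fun x => (Hs_hasFDeriv hF x).fderiv
  have hcD := hF.contD
  refine ⟨?_, fun x => ?_, ?_⟩
  · rw [contDiff_one_iff_fderiv]
    refine ⟨fun x => (Hs_hasFDeriv hF x).differentiableAt, ?_⟩
    rw [hfd]
    refine continuous_of_dominated (bound := fun _ => Λ) (fun x => by fun_prop)
      (fun x => .of_forall fun g => hF.lip _) (integrable_const _) (.of_forall fun g => by fun_prop)
  · rw [hfd]
    have := norm_integral_le_of_norm_le_const (μ := stdGaussian E)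
      (f := fun g => fderiv ℝ F (x + σ • g)) (C := Λ) (.of_forall fun g => hF.lip _)
    simpa using this
  · obtain ⟨C, hC⟩ := hF.bdd
    exact ⟨C, Hs_bdd hC⟩

lemma Hs_fderiv_lip {Λ σ : ℝ} {F : E → ℝ} (hF : Good Λ F) (hσ : 0 < σ) (x y : E) :
    ‖fderiv ℝ (Hs σ F) x - fderiv ℝ (Hs σ F) y‖
      ≤ (Λ / σ * ∫ g : E, ‖g‖ ∂(stdGaussian E)) * ‖x - y‖ := by
  have hΛ := hF.nonneg
  have hm : 0 ≤ ∫ g : E, ‖g‖ ∂(stdGaussian E) := integral_nonneg fun g => norm_nonneg _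
  have hc := hF.cont
  obtain ⟨C, hC⟩ := hF.bdd
  refine ContinuousLinearMap.opNorm_le_bound _ (by positivity) fun v => ?_
  rw [(Hs_hasFDeriv hF x).fderiv, (Hs_hasFDeriv hF y).fderiv, sub_apply,
    ContinuousLinearMap.integral_apply (hF.intD_shift x),
    ContinuousLinearMap.integral_apply (hF.intD_shift y)]
  have sx := stein hF hσ.le x v
  have sy := stein hF hσ.le y v
  have ii : ∀ z, Integrable (fun g => F (z + σ • g) * inner ℝ v g) (stdGaussian E) := fun z =>
    (g_int_inner v).bdd_mul (c := C) (by fun_prop) (.of_forall fun g => hC _)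
  have e : σ * (∫ g, fderiv ℝ F (x + σ • g) v ∂(stdGaussian E)
      - ∫ g, fderiv ℝ F (y + σ • g) v ∂(stdGaussian E))
      = ∫ g, (F (x + σ • g) - F (y + σ • g)) * inner ℝ v g ∂(stdGaussian E) := by
    rw [mul_sub, ← sx, ← sy, ← integral_sub (ii x) (ii y)]
    simp_rw [sub_mul]
  have b : ‖∫ g, (F (x + σ • g) - F (y + σ • g)) * inner ℝ v g ∂(stdGaussian E)‖
      ≤ ∫ g : E, (Λ * ‖x - y‖ * ‖v‖) * ‖g‖ ∂(stdGaussian E) := by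
    refine norm_integral_le_of_norm_le (g_int_norm.const_mul _) (.of_forall fun g => ?_)
    have h1 := hF.dist (x + σ • g) (y + σ • g)
    rw [add_sub_add_right_eq_sub] at h1
    have h2 := norm_inner_le_norm (𝕜 := ℝ) v g
    rw [norm_mul, mul_assoc]
    exact mul_le_mul h1 h2 (norm_nonneg _) (by positivity)
  rw [← e, integral_const_mul, norm_mul, Real.norm_of_nonneg hσ.le] at b
  rw [show Λ / σ * (∫ g : E, ‖g‖ ∂(stdGaussian E)) * ‖x - y‖ * ‖v‖
    = (Λ * ‖x - y‖ * ‖v‖ * (∫ g : E, ‖g‖ ∂(stdGaussian E))) / σ by ring, le_div_iff₀ hσ]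
  linarith

/-- contraction maps used in the chain -/
structure Contr (q : ℝ) (p : E → E) : Prop where
  cd : ContDiff ℝ 1 p
  le : ∀ x, ‖fderiv ℝ p x‖ ≤ q

lemma comp_good {Λ q : ℝ} {F : E → ℝ} {p : E → E} (hF : Good Λ F) (hp : Contr q p) :
    Good (Λ * q) (fun x => F (p x)) ∧
    ∀ x, fderiv ℝ (fun x => F (p x)) x = (fderiv ℝ F (p x)).comp (fderiv ℝ p x) := by
  have hd : ∀ x, fderiv ℝ (fun x => F (p x)) x = (fderiv ℝ F (p x)).comp (fderiv ℝ p x) := fun x =>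
    ((hF.hasFDeriv (p x)).comp x
      ((hp.cd.differentiable (by norm_num)) x).hasFDerivAt).fderiv
  refine ⟨⟨hF.cd.comp hp.cd, fun x => ?_, ?_⟩, hd⟩
  · rw [hd]
    refine (ContinuousLinearMap.opNorm_comp_le _ _).trans ?_
    exact mul_le_mul (hF.lip _) (hp.le x) (norm_nonneg _) hF.nonneg
  · obtain ⟨C, hC⟩ := hF.bdd
    exact ⟨C, fun x => hC _⟩

lemma Good.mono {Λ Λ' : ℝ} {F : E → ℝ} (hF : Good Λ F) (h : Λ ≤ Λ') : Good Λ' F :=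
  ⟨hF.cd, fun x => (hF.lip x).trans h, hF.bdd⟩

noncomputable def Qs (p : E → E) (σ : ℝ) (F : E → ℝ) (x : E) : ℝ := Hs σ F (p x)

lemma Qs_good {Λ σ : ℝ} {F : E → ℝ} {p : E → E} (hF : Good Λ F) (hp : Contr 1 p) :
    Good Λ (Qs p σ F) := by
  have := (comp_good (Hs_good (σ := σ) hF) hp).1
  rw [mul_one] at this
  exact this

lemma Qs_fderiv_le {Λ σ : ℝ} {F : E → ℝ} {p : E → E} (hF : Good Λ F) (hp : Contr 1 p) (x : E) :
    ‖fderiv ℝ (Qs p σ F) x‖ ≤ ‖∫ g, fderiv ℝ F (p x + σ • g) ∂(stdGaussian E)‖ := by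
  have := (comp_good (Hs_good (σ := σ) hF) hp).2 x
  have e : fderiv ℝ (Qs p σ F) x = _ := this
  rw [e, (Hs_hasFDeriv hF (p x)).fderiv]
  refine (ContinuousLinearMap.opNorm_comp_le _ _).trans ?_
  exact mul_le_of_le_one_right (norm_nonneg _) (hp.le x)

lemma Qs_mono {Λ Λ' σ : ℝ} {F G : E → ℝ} {p : E → E} (hF : Good Λ F) (hG : Good Λ' G)
    (h : ∀ x, F x ≤ G x) (x : E) : Qs p σ F x ≤ Qs p σ G x :=
  integral_mono (hF.int_shift _) (hG.int_shift _) fun g => h _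

lemma Qs_const {σ c : ℝ} {p : E → E} (x : E) : Qs p σ (fun _ => c) x = c := by
  simp [Qs, Hs]

lemma Good.const (c : ℝ) : Good 0 (fun _ : E => c) :=
  ⟨contDiff_const, fun x => by simp, |c|, fun x => le_rfl⟩

lemma sqrt_step (j : ℕ) (hj : 1 ≤ j) : 1 / √(j:ℝ) ≤ 3 * (√((j + 1 : ℕ):ℝ) - √(j:ℝ)) := by
  have hj' : (1:ℝ) ≤ j := by exact_mod_cast hj
  have h1 : 1 ≤ √(j:ℝ) := by rw [Real.one_le_sqrt]; exact hj'
  have h2 := Real.sq_sqrt (show (0:ℝ) ≤ j by positivity)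
  have h3 := Real.sq_sqrt (show (0:ℝ) ≤ ((j+1 : ℕ):ℝ) by positivity)
  push_cast at *
  set a := √(j:ℝ)
  set b := √((j:ℝ)+1)
  have hb : 0 ≤ b := Real.sqrt_nonneg _
  have hab : b ≤ 3 / 2 * a := by
    by_contra hcon
    push Not at hcon
    nlinarith
  have hab2 : a ≤ b := by nlinarith
  rw [div_le_iff₀ (by linarith)]
  have : (b - a) * (b + a) = 1 := by nlinarith
  nlinarith

lemma jensen_sq {μ : Measure E} [IsProbabilityMeasure μ] {φ : E → ℝ} {C : ℝ} (hφ : Continuous φ)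
    (hC : ∀ x, |φ x| ≤ C) : (∫ x, φ x ∂μ) ^ 2 ≤ ∫ x, φ x ^ 2 ∂μ := by
  have i1 : Integrable φ μ := Integrable.of_bound (by fun_prop) C (.of_forall hC)
  have i2 : Integrable (fun x => φ x ^ 2) μ := Integrable.of_bound (by fun_prop) (C ^ 2)
    (.of_forall fun x => by
      rw [norm_pow]; exact pow_le_pow_left₀ (norm_nonneg _) (hC x) 2)
  have p : 0 ≤ ∫ x, (φ x - ∫ y, φ y ∂μ) ^ 2 ∂μ := integral_nonneg fun x => sq_nonneg _
  set m := ∫ y, φ y ∂μ with hm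
  have : ∀ x, (φ x - m) ^ 2 = φ x ^ 2 - (2 * m) * φ x + m ^ 2 := fun x => by ring
  simp_rw [this] at p
  rw [integral_add (i2.sub' (i1.const_mul _)) (integrable_const _), integral_sub i2 (i1.const_mul _),
    integral_const_mul, ← hm] at p
  simp at p
  nlinarith

lemma iter {Λ σ : ℝ} (hσ : 0 < σ) {f G : E → ℝ} {p : E → E} (hp : Contr 1 p) (hf : Good Λ f)
    (hG : Good Λ G) (hf0 : ∀ x, 0 ≤ f x) (hf1 : ∀ x, f x ≤ 1) (hfG : ∀ x, ‖fderiv ℝ f x‖ ≤ G x)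
    (j : ℕ) : ∃ h k Γ : E → ℝ, h = (Qs p σ)^[j] f ∧ k = (Qs p σ)^[j] (fun x => f x ^ 2) ∧
      Γ = (Qs p σ)^[j] G ∧ Good Λ h ∧ (∀ x, 0 ≤ h x) ∧ (∀ x, h x ≤ 1) ∧ Good (2 * Λ) k ∧
      (∀ x, k x ≤ 1) ∧ Good Λ Γ ∧ (∀ x, ‖fderiv ℝ h x‖ ≤ Γ x) ∧
      (∀ x, j * σ ^ 2 * ‖fderiv ℝ h x‖ ^ 2 ≤ k x - h x ^ 2) ∧
      (∀ x, k x - h x ^ 2 ≤ Real.pi ^ 2 / 8 * σ ^ 2 * (Λ + 3 * √(j:ℝ) / σ) * Γ x) := by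
  induction j with
  | zero =>
    have hfa : ∀ x, |f x| ≤ 1 := fun x => abs_le.2 ⟨by linarith [hf0 x], hf1 x⟩
    have hG0 : ∀ x, 0 ≤ G x := fun x => (norm_nonneg _).trans (hfG x)
    refine ⟨_, _, _, rfl, rfl, rfl, hf, hf0, hf1, ?_, fun x => ?_, hG, hfG, fun x => ?_, fun x => ?_⟩
    · have := hf.mul hf hfa hfa
      simp_rw [← sq] at this
      exact this.mono (by linarith)
    · have := hf0 x; have := hf1 x
      simp only [Function.iterate_zero, id]; nlinarith
    · simp
    · have := hG0 x
      have := hf.nonneg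
      simp
      positivity
  | succ j ih =>
    obtain ⟨h, k, Γ, rh, rk, rΓ, gh, h0, h1, gk, k1, gΓ, hhΓ, hlow, hup⟩ := ih
    have hΛ := hf.nonneg
    have hha : ∀ x, |h x| ≤ 1 := fun x => abs_le.2 ⟨by linarith [h0 x], h1 x⟩
    have gh2 : Good (2 * Λ) (fun x => h x ^ 2) := by
      have := gh.mul gh hha hha
      simp_rw [← sq] at this
      exact this.mono (by linarith)
    have hcD := gh.contD
    have hΓ0 : ∀ x, 0 ≤ Γ x := fun x => (norm_nonneg _).trans (hhΓ x)
    refine ⟨Qs p σ h, Qs p σ k, Qs p σ Γ, ?_, ?_, ?_, Qs_good gh hp, fun x => ?_, fun x => ?_,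
      Qs_good gk hp, fun x => ?_, Qs_good gΓ hp, fun x => ?_, fun x => ?_, fun x => ?_⟩
    · rw [Function.iterate_succ_apply', rh]
    · rw [Function.iterate_succ_apply', rk]
    · rw [Function.iterate_succ_apply', rΓ]
    · exact integral_nonneg fun g => h0 _
    · rw [← Qs_const (σ := σ) (c := 1) (p := p) x]
      exact Qs_mono gh (Good.const 1) h1 x
    · rw [← Qs_const (σ := σ) (c := 1) (p := p) x]
      exact Qs_mono gk (Good.const 1) k1 x
    · refine (Qs_fderiv_le gh hp x).trans ?_
      refine norm_integral_le_of_norm_le (gΓ.int_shift _) (.of_forall fun g => hhΓ _)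
    all_goals
      have iU : ∫ g, (k (p x + σ • g) - h (p x + σ • g) ^ 2) ∂(stdGaussian E)
          = Qs p σ k x - ∫ g, h (p x + σ • g) ^ 2 ∂(stdGaussian E) :=
        integral_sub (gk.int_shift _) (gh2.int_shift _)
      have iUi : Integrable (fun g => k (p x + σ • g) - h (p x + σ • g) ^ 2) (stdGaussian E) :=
        (gk.int_shift _).sub (gh2.int_shift _)
      have iD : Integrable (fun g => ‖fderiv ℝ h (p x + σ • g)‖ ^ 2) (stdGaussian E) :=
        Integrable.of_bound (by fun_prop) (Λ ^ 2) (.of_forall fun g => by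
          rw [norm_pow, norm_norm]; exact pow_le_pow_left₀ (norm_nonneg _) (gh.lip _) 2)
      have hQ : Qs p σ h x = ∫ g, h (p x + σ • g) ∂(stdGaussian E) := rfl
    · have a1 : ∫ g, j * σ ^ 2 * ‖fderiv ℝ h (p x + σ • g)‖ ^ 2 ∂(stdGaussian E)
          ≤ ∫ g, (k (p x + σ • g) - h (p x + σ • g) ^ 2) ∂(stdGaussian E) :=
        integral_mono (iD.const_mul _) iUi fun g => hlow _
      rw [integral_const_mul, iU] at a1
      have a2 := N2 gh hσ.le (p x)
      rw [← hQ] at a2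
      have a3 := Qs_fderiv_le (σ := σ) gh hp x
      have a4 := jensen_sq (μ := stdGaussian E) (φ := fun g => ‖fderiv ℝ h (p x + σ • g)‖) (C := Λ)
        (by fun_prop) (fun g => by rw [abs_norm]; exact gh.lip _)
      have a5 := norm_integral_le_integral_norm (μ := stdGaussian E)
        (fun g => fderiv ℝ h (p x + σ • g))
      set A := ‖∫ g, fderiv ℝ h (p x + σ • g) ∂(stdGaussian E)‖
      set B := ∫ g, ‖fderiv ℝ h (p x + σ • g)‖ ∂(stdGaussian E)
      set D := ‖fderiv ℝ (Qs p σ h) x‖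
      have hD : 0 ≤ D := norm_nonneg _
      have hA : 0 ≤ A := norm_nonneg _
      have b1 : D ^ 2 ≤ A ^ 2 := pow_le_pow_left₀ hD a3 2
      have b2 : A ^ 2 ≤ B ^ 2 := pow_le_pow_left₀ hA a5 2
      have b3 : j * σ ^ 2 * D ^ 2 ≤ j * σ ^ 2 *
          ∫ g, ‖fderiv ℝ h (p x + σ • g)‖ ^ 2 ∂(stdGaussian E) := by
        gcongr; linarith
      have b4 : σ ^ 2 * D ^ 2 ≤ σ ^ 2 * A ^ 2 := by gcongr
      push_cast
      linarith
    · have iΓ : ∫ g, Γ (p x + σ • g) ∂(stdGaussian E) = Qs p σ Γ x := rfl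
      have hQΓ : 0 ≤ Qs p σ Γ x := integral_nonneg fun g => hΓ0 _
      set c := Real.pi ^ 2 / 8 * σ ^ 2 with hc
      have hc0 : 0 ≤ c := by positivity
      have a1 : ∫ g, (k (p x + σ • g) - h (p x + σ • g) ^ 2) ∂(stdGaussian E)
          ≤ ∫ g, c * (Λ + 3 * √(j:ℝ) / σ) * Γ (p x + σ • g) ∂(stdGaussian E) :=
        integral_mono iUi ((gΓ.int_shift _).const_mul _) fun g => hup _
      rw [integral_const_mul, iU, iΓ] at a1
      have a2 := N1 gh hσ.le (p x)
      rw [← hQ, ← hc] at a2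
      have key : ∀ ℓ : ℝ, (∀ y, ‖fderiv ℝ h y‖ ≤ ℓ) →
          ∫ g, ‖fderiv ℝ h (p x + σ • g)‖ ^ 2 ∂(stdGaussian E) ≤ ℓ * Qs p σ Γ x := by
        intro ℓ hℓ
        rw [← iΓ, ← integral_const_mul]
        refine integral_mono iD ((gΓ.int_shift _).const_mul _) fun g => ?_
        simp only [sq]
        exact mul_le_mul (hℓ _) (hhΓ _) (norm_nonneg _) ((norm_nonneg _).trans (hℓ 0))
      rcases Nat.eq_zero_or_pos j with rfl | hj
      · have b := mul_le_mul_of_nonneg_left (key Λ gh.lip) hc0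
        have e0 : √((0:ℕ):ℝ) = 0 := by simp
        have hU0 : ∀ y, k y - h y ^ 2 = 0 := by
          intro y; simp [rk, rh]
        have : Qs p σ k x - ∫ g, h (p x + σ • g) ^ 2 ∂(stdGaussian E) = 0 := by
          rw [← iU]; simp [hU0]
        have : c * (Λ * Qs p σ Γ x) ≤ c * (Λ + 3 * √((0 + 1 : ℕ):ℝ) / σ) * Qs p σ Γ x := by
          rw [← mul_assoc]
          gcongr
          have : 0 ≤ 3 * √((0 + 1 : ℕ):ℝ) / σ := by positivity
          linarith
        linarith
      · have hj' : (0:ℝ) < j := by exact_mod_cast hj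
        have hs : 0 < √(j:ℝ) := Real.sqrt_pos.2 hj'
        have hb : ∀ y, ‖fderiv ℝ h y‖ ≤ 1 / (σ * √(j:ℝ)) := by
          intro y
          have h1 := hlow y
          have h2 : k y - h y ^ 2 ≤ 1 := by nlinarith [k1 y, sq_nonneg (h y)]
          rw [le_div_iff₀ (by positivity)]
          have h3 := Real.sq_sqrt hj'.le
          refine abs_le_of_sq_le_sq' (b := 1) ?_ (by norm_num) |>.2
          rw [mul_pow, mul_pow, h3]
          nlinarith
        have b := mul_le_mul_of_nonneg_left (key _ hb) hc0
        have st := sqrt_step j hj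
        have : c * (Λ + 3 * √(j:ℝ) / σ) * Qs p σ Γ x + c * (1 / (σ * √(j:ℝ)) * Qs p σ Γ x)
            ≤ c * (Λ + 3 * √((j + 1 : ℕ):ℝ) / σ) * Qs p σ Γ x := by
          rw [← mul_assoc, ← add_mul, ← mul_add]
          refine mul_le_mul_of_nonneg_right (mul_le_mul_of_nonneg_left ?_ hc0) hQΓ
          have : 1 / (σ * √(j:ℝ)) = (1 / √(j:ℝ)) / σ := by rw [div_div, mul_comm]
          rw [this, add_assoc, ← add_div]
          gcongr
          linarith
        linarith

end BLM

namespace BLM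
open MeasureTheory ProbabilityTheory
open scoped ENNReal
set_option linter.unusedSectionVars false
set_option linter.unusedVariables false

variable {E : Type*} [NormedAddCommGroup E] [InnerProductSpace ℝ E] [FiniteDimensional ℝ E]
  [MeasurableSpace E] [BorelSpace E]

def InvErr (μ : Measure E) (p : E → E) (σ e : ℝ) : Prop :=
  ∀ (Λ : ℝ) (F : E → ℝ), Good Λ F → |∫ x, Qs p σ F x ∂μ - ∫ x, F x ∂μ| ≤ Λ * e

lemma InvErr.iter {μ : Measure E} {p : E → E} {σ e : ℝ} (h : InvErr μ p σ e) (hp : Contr 1 p)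
    {Λ : ℝ} {F : E → ℝ} (hF : Good Λ F) (j : ℕ) :
    Good Λ ((Qs p σ)^[j] F) ∧ |∫ x, (Qs p σ)^[j] F x ∂μ - ∫ x, F x ∂μ| ≤ j * (Λ * e) := by
  induction j with
  | zero => simpa using hF
  | succ j ih =>
    obtain ⟨h1, h2⟩ := ih
    rw [Function.iterate_succ_apply']
    refine ⟨Qs_good h1 hp, ?_⟩
    have h3 := h Λ _ h1
    have := abs_sub_le (∫ x, Qs p σ ((Qs p σ)^[j] F) x ∂μ) (∫ x, (Qs p σ)^[j] F x ∂μ) (∫ x, F x ∂μ)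
    push_cast
    linarith

def Conc (μ : Measure E) (B r : ℝ) : Prop :=
  ∀ u : E → ℝ, LipschitzWith 1 u → (∀ x, 0 ≤ u x) → (∀ x, u x ≤ B) →
    ∃ α, 0 ≤ α ∧ α ≤ B ∧ ∫ x, |u x - α| ∂μ ≤ r

lemma bulk {μ : Measure E} [IsProbabilityMeasure μ] {p : E → E} {σ e Λ B r : ℝ} {N : ℕ}
    (hσ : 0 < σ) (hN : 1 ≤ N) (hB : B = σ * √(N:ℝ)) (hp : Contr 1 p) (hinv : InvErr μ p σ e)
    (hconc : Conc μ B r) {f G : E → ℝ} (hf : Good Λ f)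
    (hG : Good Λ G) (hf0 : ∀ x, 0 ≤ f x) (hf1 : ∀ x, f x ≤ 1) (hfG : ∀ x, ‖fderiv ℝ f x‖ ≤ G x) :
    (∫ x, f x ∂μ) * (1 - ∫ x, f x ∂μ) ≤ ∫ x, f x * (1 - f x) ∂μ
      + Real.pi ^ 2 / 8 * (σ ^ 2 * Λ + 3 * B) * (∫ x, G x ∂μ + N * (Λ * e))
      + r / B + 4 * (N * (Λ * e)) := by
  have hΛ := hf.nonneg
  have hN' : (0:ℝ) < N := by exact_mod_cast hN
  have hB0 : 0 < B := by rw [hB]; positivity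
  have hfa : ∀ x, |f x| ≤ 1 := fun x => abs_le.2 ⟨by linarith [hf0 x], hf1 x⟩
  have hf2 : Good (2 * Λ) (fun x => f x ^ 2) := by
    have := hf.mul hf hfa hfa
    simp_rw [← sq] at this
    exact this.mono (by linarith)
  obtain ⟨h, k, Γ, rh, rk, rΓ, gh, h0, h1, gk, k1, gΓ, hhΓ, hlow, hup⟩ :=
    iter hσ hp hf hG hf0 hf1 hfG N
  have vh := (hinv.iter hp hf N).2
  have vk := (hinv.iter hp hf2 N).2
  have vΓ := (hinv.iter hp hG N).2
  rw [← rh] at vh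
  rw [← rk] at vk
  rw [← rΓ] at vΓ
  have hha : ∀ x, |h x| ≤ 1 := fun x => abs_le.2 ⟨by linarith [h0 x], h1 x⟩
  have gh2 : Good (2 * Λ) (fun x => h x ^ 2) := by
    have := gh.mul gh hha hha
    simp_rw [← sq] at this
    exact this.mono (by linarith)
  -- variance of h
  have hlipB : ∀ x, ‖fderiv ℝ h x‖ ≤ 1 / B := by
    intro x
    have h1 := hlow x
    have h2 : k x - h x ^ 2 ≤ 1 := by nlinarith [k1 x, sq_nonneg (h x)]
    rw [le_div_iff₀ hB0]
    refine abs_le_of_sq_le_sq' (b := 1) ?_ (by norm_num) |>.2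
    rw [mul_pow, hB, mul_pow, Real.sq_sqrt hN'.le]
    nlinarith
  have hu : LipschitzWith 1 (fun x => B * h x) := by
    refine LipschitzWith.of_dist_le_mul fun x y => ?_
    have gh' : Good (1 / B) h := ⟨gh.cd, hlipB, gh.bdd⟩
    have := gh'.dist x y
    rw [Real.dist_eq, ← mul_sub, abs_mul, abs_of_pos hB0, dist_eq_norm]
    calc B * |h x - h y| ≤ B * (1 / B * ‖x - y‖) := by gcongr
      _ = _ := by simp; field_simp
  obtain ⟨α, hα0, hαB, hα⟩ := hconc _ hu (fun x => mul_nonneg hB0.le (h0 x))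
    (fun x => mul_le_of_le_one_right hB0.le (h1 x))
  have hvar : ∫ x, h x ^ 2 ∂μ - (∫ x, h x ∂μ) ^ 2 ≤ r / B := by
    have e1 := var_eq (μ := μ) gh (α / B)
    have e2 : ∫ x, (h x - α / B) ^ 2 ∂μ ≤ ∫ x, (1 / B) * |B * h x - α| ∂μ := by
      have hc := gh.cont
      refine integral_mono_of_nonneg (.of_forall fun x => sq_nonneg _) ?_ (.of_forall fun x => ?_)
      · refine Integrable.const_mul ?_ _
        refine Integrable.abs ?_
        exact ((gh.int μ).const_mul B).sub (integrable_const _)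
      · have a1 : α / B ≤ 1 := (div_le_one hB0).2 hαB
        have a2 : 0 ≤ α / B := by positivity
        have : |h x - α / B| ≤ 1 := abs_le.2 ⟨by linarith [h0 x], by linarith [h1 x]⟩
        have e3 : (1 / B) * |B * h x - α| = |h x - α / B| := by
          rw [show B * h x - α = B * (h x - α / B) by field_simp, abs_mul, abs_of_pos hB0]
          field_simp
        simp only [e3]
        rw [← sq_abs]
        nlinarith [abs_nonneg (h x - α / B)]
    rw [integral_const_mul] at e2
    have e4 : (1 / B) * ∫ x, |B * h x - α| ∂μ ≤ r / B := by
      rw [div_mul_eq_mul_div, one_mul]; gcongr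
    nlinarith [sq_nonneg (∫ x, h x ∂μ - α / B)]
  have hU : ∫ x, k x ∂μ - ∫ x, h x ^ 2 ∂μ
      ≤ Real.pi ^ 2 / 8 * (σ ^ 2 * Λ + 3 * B) * ∫ x, Γ x ∂μ := by
    rw [← integral_sub (gk.int μ) (gh2.int μ), ← integral_const_mul]
    refine integral_mono ((gk.int μ).sub (gh2.int μ)) ((gΓ.int μ).const_mul _) fun x => ?_
    refine (hup x).trans_eq ?_
    rw [hB]; field_simp
  have hMN : ∫ x, f x * (1 - f x) ∂μ = ∫ x, f x ∂μ - ∫ x, f x ^ 2 ∂μ := by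
    rw [← integral_sub (hf.int μ) (hf2.int μ)]
    congr 1; ext x; ring
  have cpos : 0 ≤ Real.pi ^ 2 / 8 * (σ ^ 2 * Λ + 3 * B) := by positivity
  have hΓ2 : Real.pi ^ 2 / 8 * (σ ^ 2 * Λ + 3 * B) * ∫ x, Γ x ∂μ
      ≤ Real.pi ^ 2 / 8 * (σ ^ 2 * Λ + 3 * B) * (∫ x, G x ∂μ + N * (Λ * e)) := by
    refine mul_le_mul_of_nonneg_left ?_ cpos
    linarith [(abs_le.1 vΓ).2]
  have hM0 : 0 ≤ ∫ x, f x ∂μ := integral_nonneg hf0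
  have hM1 : ∫ x, f x ∂μ ≤ 1 := by
    simpa using integral_mono (hf.int μ) (integrable_const (1:ℝ)) hf1
  have hM0' : 0 ≤ ∫ x, h x ∂μ := integral_nonneg h0
  have hM1' : ∫ x, h x ∂μ ≤ 1 := by
    simpa using integral_mono (gh.int μ) (integrable_const (1:ℝ)) h1
  rw [hMN]
  have hk := (abs_le.1 vk).1
  have hh := (abs_le.1 vh).2
  set M := ∫ x, f x ∂μ
  set M' := ∫ x, h x ∂μ
  have he0 : 0 ≤ N * (Λ * e) := (abs_nonneg _).trans vh
  have : M' ^ 2 - M ^ 2 ≤ 2 * (N * (Λ * e)) := by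
    have : M' ^ 2 - M ^ 2 = (M' - M) * (M' + M) := by ring
    rw [this]
    rcases le_total (M' - M) 0 with h | h
    · nlinarith
    · nlinarith
  nlinarith

/-- abstract induction -/
lemma small_ind {μ : Measure E} [IsProbabilityMeasure μ] {p : E → E} {σ e Λ A q m1 d : ℝ}
    (hσ : 0 < σ) (hΛ : 0 < Λ) (hq0 : 0 < q) (hq1 : q ≤ 1) (hp : Contr q p) (hinv : InvErr μ p σ e)
    (hA : 0 ≤ A)
    (hbulk : ∀ f G : E → ℝ, Good Λ f → Good Λ G → (∀ x, 0 ≤ f x) → (∀ x, f x ≤ 1) →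
      (∀ x, ‖fderiv ℝ f x‖ ≤ G x) → (∫ x, f x ∂μ) * (1 - ∫ x, f x ∂μ) ≤
        ∫ x, f x * (1 - f x) ∂μ + A * ∫ x, G x ∂μ + 1 / 16)
    (him : Integrable (fun x => ‖x‖) μ) (hm1 : ∫ x, ‖x‖ ∂μ ≤ m1)
    (hid : Integrable (fun x => ‖p x - x‖) μ) (hd : ∫ x, ‖p x - x‖ ∂μ ≤ d) (hdΛ : Λ * d ≤ 1 / 8)
    (δ : ℝ) (k : ℕ) :
    ∀ f G : E → ℝ, Good Λ f → Good Λ G → (∀ x, 0 ≤ f x) → (∀ x, f x ≤ 1) →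
      (∀ x, ‖fderiv ℝ f x‖ ≤ G x) → (∀ x, ‖fderiv ℝ f x‖ * q ^ k ≤ δ) → ∫ x, f x ∂μ ≤ 3 / 4 →
      ∫ x, f x ∂μ ≤ 10 * (∫ x, f x * (1 - f x) ∂μ) + 8 * A * ∫ x, G x ∂μ + 2 * δ * m1
        + k * ((31 + 8 * A) * (Λ * e) + 4096 * Λ ^ 4 * σ ^ 4 * ∫ g : E, ‖g‖ ^ 4 ∂(stdGaussian E)) := by
  have hp1 : Contr 1 p := ⟨hp.cd, fun x => (hp.le x).trans hq1⟩
  have big : ∀ f G : E → ℝ, Good Λ f → Good Λ G → (∀ x, 0 ≤ f x) → (∀ x, f x ≤ 1) →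
      (∀ x, ‖fderiv ℝ f x‖ ≤ G x) → ∫ x, f x ∂μ ≤ 3 / 4 → 1 / 2 ≤ ∫ x, f x ∂μ →
      ∫ x, f x ∂μ ≤ 10 * (∫ x, f x * (1 - f x) ∂μ) + 8 * A * ∫ x, G x ∂μ := by
    intro f G hf hG hf0 hf1 hfG hM hM2
    have hb := hbulk f G hf hG hf0 hf1 hfG
    have h1 : 0 ≤ ∫ x, f x * (1 - f x) ∂μ :=
      integral_nonneg fun x => mul_nonneg (hf0 x) (by linarith [hf1 x])
    nlinarith
  have he0 : 0 ≤ Λ * e := by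
    have := hinv Λ (fun _ => 0) ((Good.const 0).mono hΛ.le)
    exact (abs_nonneg _).trans this
  have hm40 : 0 ≤ ∫ g : E, ‖g‖ ^ 4 ∂(stdGaussian E) := integral_nonneg fun g => by positivity
  have hm10 : 0 ≤ m1 := (integral_nonneg fun x => norm_nonneg x).trans hm1
  have herr : 0 ≤ (31 + 8 * A) * (Λ * e)
      + 4096 * Λ ^ 4 * σ ^ 4 * ∫ g : E, ‖g‖ ^ 4 ∂(stdGaussian E) := by positivity
  set err := (31 + 8 * A) * (Λ * e)
      + 4096 * Λ ^ 4 * σ ^ 4 * ∫ g : E, ‖g‖ ^ 4 ∂(stdGaussian E) with herrdef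
  induction k with
  | zero =>
    intro f G hf hG hf0 hf1 hfG hfδ hM
    have hδ : 0 ≤ δ := le_trans (by positivity) (hfδ 0)
    have h1 : 0 ≤ ∫ x, f x * (1 - f x) ∂μ :=
      integral_nonneg fun x => mul_nonneg (hf0 x) (by linarith [hf1 x])
    have hG0 : 0 ≤ ∫ x, G x ∂μ := integral_nonneg fun x => (norm_nonneg _).trans (hfG x)
    rcases le_total (1 / 2) (∫ x, f x ∂μ) with h | h
    · have := big f G hf hG hf0 hf1 hfG hM h
      have : 0 ≤ 2 * δ * m1 := by positivity
      simp only [Nat.cast_zero, zero_mul]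
      linarith
    · have hfa : ∀ x, |f x| ≤ 1 := fun x => abs_le.2 ⟨by linarith [hf0 x], hf1 x⟩
      have hf2 : Good (2 * Λ) (fun x => f x ^ 2) := by
        have := hf.mul hf hfa hfa
        simp_rw [← sq] at this
        exact this.mono (by linarith)
      have hMN : ∫ x, f x * (1 - f x) ∂μ = ∫ x, f x ∂μ - ∫ x, f x ^ 2 ∂μ := by
        rw [← integral_sub (hf.int μ) (hf2.int μ)]
        congr 1; ext x; ring
      have e1 := var_eq (μ := μ) hf (f 0)
      have gδ : Good δ f := ⟨hf.cd, fun x => by simpa using hfδ x, hf.bdd⟩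
      have e2 : ∫ x, (f x - f 0) ^ 2 ∂μ ≤ ∫ x, δ * ‖x‖ ∂μ := by
        refine integral_mono_of_nonneg (.of_forall fun x => sq_nonneg _) (him.const_mul _)
          (.of_forall fun x => ?_)
        have h2 := gδ.dist x 0
        rw [sub_zero] at h2
        have h3 : |f x - f 0| ≤ 1 := abs_le.2 ⟨by linarith [hf0 x, hf1 0], by linarith [hf1 x, hf0 0]⟩
        simp only
        rw [← sq_abs]
        nlinarith [abs_nonneg (f x - f 0)]
      rw [integral_const_mul] at e2
      have e3 : δ * ∫ x, ‖x‖ ∂μ ≤ δ * m1 := by gcongr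
      have hM0 : 0 ≤ ∫ x, f x ∂μ := integral_nonneg hf0
      have : 0 ≤ 8 * A * ∫ x, G x ∂μ := by positivity
      simp only [Nat.cast_zero, zero_mul]
      nlinarith [sq_nonneg (∫ x, f x ∂μ - f 0)]
  | succ k ih =>
    intro f G hf hG hf0 hf1 hfG hfδ hM
    have hδ : 0 ≤ δ := le_trans (by positivity) (hfδ 0)
    have h1 : 0 ≤ ∫ x, f x * (1 - f x) ∂μ :=
      integral_nonneg fun x => mul_nonneg (hf0 x) (by linarith [hf1 x])
    have hG0 : 0 ≤ ∫ x, G x ∂μ := integral_nonneg fun x => (norm_nonneg _).trans (hfG x)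
    rcases le_total (1 / 2) (∫ x, f x ∂μ) with h | h
    · have := big f G hf hG hf0 hf1 hfG hM h
      have : 0 ≤ 2 * δ * m1 := by positivity
      have : 0 ≤ ((k + 1 : ℕ):ℝ) * err := by positivity
      linarith
    · have hfa : ∀ x, |f x| ≤ 1 := fun x => abs_le.2 ⟨by linarith [hf0 x], hf1 x⟩
      have h1fa : ∀ x, |1 - f x| ≤ 1 := fun x => abs_le.2 ⟨by linarith [hf1 x], by linarith [hf0 x]⟩
      have g1f : Good Λ (fun x => 1 - f x) := by
        refine ⟨contDiff_const.sub hf.cd, fun x => ?_, 1, h1fa⟩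
        rw [((hf.hasFDeriv x).const_sub 1).fderiv, norm_neg]
        exact hf.lip x
      have gff : Good (3 * Λ) (fun x => f x * (1 - f x)) :=
        (hf.mul g1f hfa h1fa).mono (by linarith)
      have gsh : ∀ {Λ' : ℝ} {F : E → ℝ}, Good Λ' F → ∀ g : E, Good Λ' (fun x => F (x + σ • g)) ∧
          ∀ x, fderiv ℝ (fun x => F (x + σ • g)) x = fderiv ℝ F (x + σ • g) := by
        intro Λ' F hF g
        have := hF.shift (σ := 1) zero_le_one (σ • g)
        simpa [add_comm] using this
      -- Fubini
      have fub : ∀ {Λ' : ℝ} {F : E → ℝ}, Good Λ' F →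
          Integrable (fun g => ∫ x, F (p x + σ • g) ∂μ) (stdGaussian E) ∧
          ∫ g, (∫ x, F (p x + σ • g) ∂μ) ∂(stdGaussian E) = ∫ x, Qs p σ F x ∂μ := by
        intro Λ' F hF
        have hFc := hF.cont
        have hpc := hp.cd.continuous
        obtain ⟨C, hC⟩ := hF.bdd
        have hi : Integrable (Function.uncurry fun g x => F (p x + σ • g)) ((stdGaussian E).prod μ) := by
          refine Integrable.of_bound (Continuous.aestronglyMeasurable ?_) C (.of_forall fun z => hC _)
          simp only [Function.uncurry_def]; fun_prop
        refine ⟨hi.integral_prod_left, ?_⟩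
        rw [integral_integral_swap hi]
        rfl
      have pt : ∀ g : E, ∫ x, f (p x + σ • g) ∂μ ≤
          10 * (∫ x, f (p x + σ • g) * (1 - f (p x + σ • g)) ∂μ)
          + 8 * A * ∫ x, G (p x + σ • g) ∂μ + 2 * δ * m1 + k * err
          + (8 * Λ * σ) ^ 4 * ‖g‖ ^ 4 := by
        intro g
        obtain ⟨fa, fb⟩ := comp_good (gsh hf g).1 hp
        obtain ⟨Ga, Gb⟩ := comp_good (gsh hG g).1 hp
        have fle : ∀ x, ‖fderiv ℝ (fun x => f (p x + σ • g)) x‖ ≤ ‖fderiv ℝ f (p x + σ • g)‖ * q := by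
          intro x
          rw [fb, (gsh hf g).2]
          exact (ContinuousLinearMap.opNorm_comp_le _ _).trans
            (mul_le_mul_of_nonneg_left (hp.le x) (norm_nonneg _))
        have hN0 : 0 ≤ ∫ x, f (p x + σ • g) * (1 - f (p x + σ • g)) ∂μ :=
          integral_nonneg fun x => mul_nonneg (hf0 _) (by linarith [hf1 (p x + σ • g)])
        have hGG0 : 0 ≤ ∫ x, G (p x + σ • g) ∂μ :=
          integral_nonneg fun x => (norm_nonneg _).trans (hfG _)
        have hΛq : Λ * q ≤ Λ := mul_le_of_le_one_right hΛ.le hq1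
        have hl : 0 ≤ (8 * Λ * σ) ^ 4 * ‖g‖ ^ 4 := by positivity
        by_cases hMg : ∫ x, f (p x + σ • g) ∂μ ≤ 3 / 4
        · have := ih (fun x => f (p x + σ • g)) (fun x => G (p x + σ • g)) (fa.mono hΛq) (Ga.mono hΛq)
            (fun x => hf0 _) (fun x => hf1 _) (fun x => ?_) (fun x => ?_) hMg
          · linarith
          · exact (fle x).trans ((mul_le_of_le_one_right (norm_nonneg _) hq1).trans (hfG _))
          · have h2 := hfδ (p x + σ • g)
            have h3 := fle x
            rw [pow_succ'] at h2
            calc _ ≤ (‖fderiv ℝ f (p x + σ • g)‖ * q) * q ^ k := by gcongr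
              _ ≤ δ := by linarith
        · push Not at hMg
          have hM1 : ∫ x, f (p x + σ • g) ∂μ ≤ 1 := by
            simpa using integral_mono (fa.int μ) (integrable_const (1:ℝ)) (fun x => hf1 _)
          have hdiff : ∫ x, f (p x + σ • g) ∂μ - ∫ x, f x ∂μ ≤ Λ * (d + σ * ‖g‖) := by
            rw [← integral_sub (fa.int μ) (hf.int μ)]
            have : ∫ x, Λ * (‖p x - x‖ + σ * ‖g‖) ∂μ ≤ Λ * (d + σ * ‖g‖) := by
              rw [integral_const_mul, integral_add hid (integrable_const _)]
              simp only [integral_const, probReal_univ, one_smul]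
              gcongr
            refine le_trans (integral_mono ((fa.int μ).sub (hf.int μ))
              ((hid.add (integrable_const _)).const_mul _) fun x => ?_) this
            have h2 := hf.dist (p x + σ • g) x
            have h3 : ‖p x + σ • g - x‖ ≤ ‖p x - x‖ + σ * ‖g‖ := by
              rw [add_sub_right_comm]
              refine (norm_add_le _ _).trans ?_
              rw [norm_smul, Real.norm_of_nonneg hσ.le]
            refine (le_abs_self _).trans (h2.trans ?_)
            gcongr
            exact h3
          have h5 : 1 ≤ 8 * Λ * σ * ‖g‖ := by nlinarith
          have h6 : 1 ≤ (8 * Λ * σ) ^ 4 * ‖g‖ ^ 4 := by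
            rw [← mul_pow]; exact one_le_pow₀ h5
          have : 0 ≤ k * err := by positivity
          have : 0 ≤ 2 * δ * m1 := by positivity
          have : 0 ≤ 8 * A * ∫ x, G (p x + σ • g) ∂μ := by positivity
          linarith
      have i1 := (fub hf).1
      have i2 := (fub gff).1
      have i3 := (fub hG).1
      have i4 := (g_int_pow (E := E) 4).const_mul ((8 * Λ * σ) ^ 4)
      have tot := integral_mono i1 (((((i2.const_mul 10).fun_add (i3.const_mul (8 * A))).fun_add
        (integrable_const (2 * δ * m1))).fun_add (integrable_const (k * err))).fun_add i4) pt
      rw [integral_add ((((i2.const_mul 10).fun_add (i3.const_mul (8 * A))).fun_add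
        (integrable_const (2 * δ * m1))).fun_add (integrable_const (k * err))) i4,
        integral_add (((i2.const_mul 10).fun_add (i3.const_mul (8 * A))).fun_add
        (integrable_const (2 * δ * m1))) (integrable_const (k * err)),
        integral_add ((i2.const_mul 10).fun_add (i3.const_mul (8 * A)))
        (integrable_const (2 * δ * m1)),
        integral_add (i2.const_mul 10) (i3.const_mul (8 * A)), integral_const_mul, integral_const_mul,
        integral_const_mul, (fub hf).2, (fub gff).2, (fub hG).2] at tot
      simp only [integral_const, probReal_univ, one_smul] at tot
      have v1 := (abs_le.1 (hinv _ _ hf)).1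
      have v2 := (abs_le.1 (hinv _ _ gff)).2
      have v3 := (abs_le.1 (hinv _ _ hG)).2
      have v3' := mul_le_mul_of_nonneg_left v3 (show 0 ≤ 8 * A by positivity)
      have e4 : (8 * Λ * σ) ^ 4 = 4096 * Λ ^ 4 * σ ^ 4 := by ring
      rw [e4, integral_const_mul] at tot
      have e5 : ((k + 1 : ℕ):ℝ) * err = k * err + err := by push_cast; ring
      have e6 : (31 + 8 * A) * (Λ * e) = 31 * (Λ * e) + 8 * A * (Λ * e) := by ring
      have e7 : 3 * Λ * e = 3 * (Λ * e) := by ring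
      rw [e7] at v2
      rw [e5]
      rw [mul_sub] at v3'
      linarith

end BLM

namespace BLM
open MeasureTheory ProbabilityTheory
open scoped ENNReal
set_option linter.unusedSectionVars false
set_option linter.unusedVariables false

variable {E : Type*} [NormedAddCommGroup E] [InnerProductSpace ℝ E] [FiniteDimensional ℝ E]
  [MeasurableSpace E] [BorelSpace E]

def ChainOK (μ : Measure E) (lam C s0 : ℝ) : Prop :=
  ∀ s : ℝ, 0 < s → s < s0 → ∃ p : E → E, Contr (√(1 - s * lam)) p ∧
    InvErr μ p (√(2 * s)) (C * (s * √s)) ∧ Integrable (fun x => ‖p x - x‖) μ ∧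
    ∫ x, ‖p x - x‖ ∂μ ≤ C * s

set_option maxHeartbeats 800000 in
lemma nice_thm {μ : Measure E} [IsProbabilityMeasure μ] {lam C s0 R : ℝ} (hlam : 0 < lam)
    (hs0 : 0 < s0) (hR : 0 < R) (hch : ChainOK μ lam C s0) (him : Integrable (fun x => ‖x‖) μ)
    (hconc : Conc μ (64 * R) (2 * R)) {Λ : ℝ} {f G : E → ℝ} (hf' : Good Λ f) (hG' : Good Λ G)
    (hf0 : ∀ x, 0 ≤ f x) (hf1 : ∀ x, f x ≤ 1) (hfG : ∀ x, ‖fderiv ℝ f x‖ ≤ G x)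
    (hM : ∫ x, f x ∂μ ≤ 3 / 4) :
    ∫ x, f x ∂μ ≤ 10 * (∫ x, f x * (1 - f x) ∂μ) + 2560 * R * ∫ x, G x ∂μ := by
  have hΛ0 := hf'.nonneg
  obtain ⟨L, hL, hf, hG⟩ : ∃ L, 0 < L ∧ Good L f ∧ Good L G :=
    ⟨Λ + 1, by linarith, hf'.mono (by linarith), hG'.mono (by linarith)⟩
  set m1 := ∫ x, ‖x‖ ∂μ
  have hm1 : 0 ≤ m1 := integral_nonneg fun x => norm_nonneg x
  set m4 := ∫ g : E, ‖g‖ ^ 4 ∂(stdGaussian E)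
  set B := 64 * R with hB
  have hB0 : 0 < B := by positivity
  set A := 5 * B with hA
  have hA0 : 0 < A := by positivity
  refine le_of_forall_pos_le_add fun η hη => ?_
  obtain ⟨δ, hδ, hδη⟩ : ∃ δ, 0 < δ ∧ 2 * δ * m1 ≤ η / 2 := by
    refine ⟨η / (4 * (m1 + 1)), by positivity, ?_⟩
    rw [show 2 * (η / (4 * (m1 + 1))) * m1 = (η / 2) * (m1 / (m1 + 1)) by field_simp; ring]
    exact mul_le_of_le_one_right (by positivity) ((div_le_one (by positivity)).2 (by linarith))
  set c := 2 / lam * |Real.log (L / δ)| with hc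
  have hc0 : 0 ≤ c := by positivity
  have tend : ∀ φ : ℝ → ℝ, Continuous φ → φ 0 = 0 → ∀ ε > 0, ∀ᶠ s in nhdsWithin (0:ℝ) (Set.Ioi 0),
      φ s < ε := by
    intro φ hφ h0 ε hε
    have : Filter.Tendsto φ (nhdsWithin (0:ℝ) (Set.Ioi 0)) (nhds 0) := by
      have := hφ.continuousWithinAt (s := Set.Ioi 0) (x := 0)
      rw [ContinuousWithinAt, h0] at this; exact this
    exact this.eventually_lt_const hε
  have ev := ((tend (fun s => s) (by fun_prop) rfl s0 hs0).and
    ((tend (fun s => s * lam) (by fun_prop) (by simp) 1 one_pos).and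
    ((tend (fun s => 2 * s * L) (by fun_prop) (by simp) B hB0).and
    ((tend (fun s => (A + 4) * (L * (B ^ 2 / 2 * C * √s))) (by fun_prop) (by simp) (1 / 32)
      (by norm_num)).and
    ((tend (fun s => L * (C * s)) (by fun_prop) (by simp) (1 / 8) (by norm_num)).and
    (tend (fun s => (c + s) * ((31 + 8 * A) * (L * (C * √s)) + 4096 * L ^ 4 * (4 * s) * m4))
      (by fun_prop) (by simp) (η / 2) (by positivity)))))))
  have tN : Filter.Tendsto (fun N : ℕ => B ^ 2 / 2 / (N:ℝ)) Filter.atTop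
      (nhdsWithin (0:ℝ) (Set.Ioi 0)) := by
    refine tendsto_nhdsWithin_iff.2 ⟨tendsto_const_div_atTop_nhds_zero_nat _, ?_⟩
    filter_upwards [Filter.eventually_ge_atTop 1] with N hN
    have : (0:ℝ) < N := by exact_mod_cast hN
    simp only [Set.mem_Ioi]; positivity
  obtain ⟨N, ⟨hs1, hs2, hs3, hs4, hs5, hs6⟩, hN⟩ :=
    ((tN.eventually ev).and (Filter.eventually_ge_atTop 1)).exists
  have hN' : (0:ℝ) < N := by exact_mod_cast hN
  set s := B ^ 2 / 2 / (N:ℝ) with hs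
  have hsp : 0 < s := by positivity
  have hNs : (N:ℝ) * s = B ^ 2 / 2 := by rw [hs]; field_simp
  obtain ⟨p, hp, hinv, hid, hd⟩ := hch s hsp hs1
  set σ := √(2 * s) with hσd
  have hσ : 0 < σ := Real.sqrt_pos.2 (by positivity)
  have hσ2 : σ ^ 2 = 2 * s := Real.sq_sqrt (by positivity)
  set q := √(1 - s * lam) with hqd
  have hq0 : 0 < q := Real.sqrt_pos.2 (by linarith)
  have hq1 : q ≤ 1 := by
    rw [hqd, Real.sqrt_le_left one_pos.le]; linarith [mul_pos hsp hlam]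
  have hp1 : Contr 1 p := ⟨hp.cd, fun x => (hp.le x).trans hq1⟩
  have hBσ : B = σ * √(N:ℝ) := by
    rw [hσd, ← Real.sqrt_mul (by positivity), show 2 * s * N = B ^ 2 by nlinarith,
      Real.sqrt_sq hB0.le]
  have hNe : (N:ℝ) * (L * (C * (s * √s))) = L * (B ^ 2 / 2 * C * √s) := by
    rw [← hNs]; ring
  have hpi : Real.pi ^ 2 / 8 ≤ 5 / 4 := by
    nlinarith [Real.pi_lt_d2, Real.pi_pos]
  have hbulk : ∀ f G : E → ℝ, Good L f → Good L G → (∀ x, 0 ≤ f x) → (∀ x, f x ≤ 1) →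
      (∀ x, ‖fderiv ℝ f x‖ ≤ G x) → (∫ x, f x ∂μ) * (1 - ∫ x, f x ∂μ) ≤
        ∫ x, f x * (1 - f x) ∂μ + A * ∫ x, G x ∂μ + 1 / 16 := by
    intro f G hf hG hf0 hf1 hfG
    have hb := bulk hσ hN hBσ hp1 hinv hconc hf hG hf0 hf1 hfG
    have he0 : 0 ≤ (N:ℝ) * (L * (C * (s * √s))) := by
      have := hinv _ _ hf
      have := (abs_nonneg _).trans this
      positivity
    have hG0 : 0 ≤ ∫ x, G x ∂μ := integral_nonneg fun x => (norm_nonneg _).trans (hfG x)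
    have h2 : 2 * R / B = 1 / 32 := by rw [hB]; field_simp; norm_num
    have h3 : Real.pi ^ 2 / 8 * (σ ^ 2 * L + 3 * B) ≤ A := by
      rw [hσ2, hA]
      calc Real.pi ^ 2 / 8 * (2 * s * L + 3 * B) ≤ 5 / 4 * (2 * s * L + 3 * B) := by gcongr
        _ ≤ _ := by linarith
    have h4 : Real.pi ^ 2 / 8 * (σ ^ 2 * L + 3 * B) * (∫ x, G x ∂μ + N * (L * (C * (s * √s))))
      ≤ A * (∫ x, G x ∂μ + N * (L * (C * (s * √s)))) := by gcongr
    rw [h2] at hb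
    rw [hNe] at hb h4
    linarith
  set K := ⌈c / s⌉₊ with hK
  have hK1 : c / s ≤ K := Nat.le_ceil _
  have hK2 : (K:ℝ) ≤ c / s + 1 := (Nat.ceil_lt_add_one (by positivity)).le
  have hqK : ∀ x, ‖fderiv ℝ f x‖ * q ^ K ≤ δ := by
    intro x
    have h1 : q ≤ Real.exp (-(s * lam) / 2) := by
      rw [hqd, Real.sqrt_le_left (Real.exp_pos _).le, ← Real.exp_nat_mul]
      have := Real.add_one_le_exp (-(s * lam))
      have e : ((2:ℕ):ℝ) * (-(s * lam) / 2) = -(s * lam) := by push_cast; ring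
      rw [e]; linarith
    have h2 : q ^ K ≤ Real.exp (-(lam * c) / 2) := by
      refine (pow_le_pow_left₀ hq0.le h1 K).trans ?_
      rw [← Real.exp_nat_mul, Real.exp_le_exp]
      rw [div_le_iff₀ hsp] at hK1
      have := mul_le_mul_of_nonneg_right hK1 hlam.le
      linarith
    have h3 : lam * c / 2 = |Real.log (L / δ)| := by rw [hc]; field_simp
    have h4 : Real.exp (-(lam * c) / 2) ≤ δ / L := by
      rw [neg_div, h3, ← Real.exp_log (show 0 < δ / L by positivity), Real.exp_le_exp,
        show δ / L = (L / δ)⁻¹ by rw [inv_div], Real.log_inv]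
      linarith [le_abs_self (Real.log (L / δ))]
    calc ‖fderiv ℝ f x‖ * q ^ K ≤ L * (δ / L) := by
          gcongr
          · exact hf.lip x
          · exact h2.trans h4
      _ = δ := by field_simp
  have fin := small_ind hσ hL hq0 hq1 hp hinv hA0.le hbulk him le_rfl hid hd hs5.le δ K f G hf hG
    hf0 hf1 hfG hqK hM
  have hσ4 : σ ^ 4 = 4 * s ^ 2 := by
    rw [show σ ^ 4 = (σ ^ 2) ^ 2 by ring, hσ2]; ring
  have he : 0 ≤ L * (C * (s * √s)) := (abs_nonneg _).trans (hinv _ _ hf)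
  have hm4 : 0 ≤ m4 := integral_nonneg fun g => by positivity
  have hlast : (K:ℝ) * ((31 + 8 * A) * (L * (C * (s * √s))) + 4096 * L ^ 4 * σ ^ 4 * m4) ≤ η / 2 := by
    have h1 : (K:ℝ) * ((31 + 8 * A) * (L * (C * (s * √s))) + 4096 * L ^ 4 * σ ^ 4 * m4)
      ≤ (c / s + 1) * ((31 + 8 * A) * (L * (C * (s * √s))) + 4096 * L ^ 4 * σ ^ 4 * m4) := by
      gcongr
    refine h1.trans (le_trans (le_of_eq ?_) hs6.le)
    rw [hσ4]
    field_simp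
  have e8 : 8 * A = 2560 * R := by rw [hA, hB]; ring
  rw [e8] at fin hlast
  linarith

end BLM

namespace BLM
open MeasureTheory ProbabilityTheory
open scoped ENNReal
set_option linter.unusedSectionVars false
set_option linter.unusedVariables false

variable {E : Type*} [NormedAddCommGroup E] [InnerProductSpace ℝ E] [FiniteDimensional ℝ E]
  [MeasurableSpace E] [BorelSpace E]

lemma enorm_intv_le {G : Type*} [NormedAddCommGroup G] [NormedSpace ℝ G] (f : ℝ → G) :
    ‖∫ t in (0:ℝ)..1, f t‖ₑ ≤ ∫⁻ t in Set.Ioc (0:ℝ) 1, ‖f t‖ₑ := by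
  rw [intervalIntegral.integral_of_le zero_le_one]
  exact enorm_integral_le_lintegral_enorm _

lemma TL {ν : Measure E} [ν.IsAddHaarMeasure] {Y : E → E} (hY : ContDiff ℝ 1 Y) (w : E) :
    ∫⁻ x, ‖Y (x + w) - Y x‖ₑ ∂ν ≤ ‖w‖ₑ * ∫⁻ x, ‖fderiv ℝ Y x‖ₑ ∂ν := by
  have hd : Differentiable ℝ Y := hY.differentiable (by norm_num)
  have hc : Continuous (fderiv ℝ Y) := hY.continuous_fderiv (by norm_num)
  have key : ∀ x, ‖Y (x + w) - Y x‖ₑ ≤ ∫⁻ t in Set.Ioc (0:ℝ) 1, ‖fderiv ℝ Y (x + t • w)‖ₑ * ‖w‖ₑ := by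
    intro x
    have h1 : ∀ t ∈ Set.uIcc (0:ℝ) 1, HasDerivAt (fun t : ℝ => Y (x + t • w)) (fderiv ℝ Y (x + t • w) w) t := by
      intro t _
      have h2 : HasDerivAt (fun t : ℝ => x + t • w) w t := by
        simpa using ((hasDerivAt_id t).smul_const w).const_add x
      exact (hd (x + t • w)).hasFDerivAt.comp_hasDerivAt t h2
    have h3 := intervalIntegral.integral_eq_sub_of_hasDerivAt h1
      (Continuous.intervalIntegrable (by fun_prop) _ _)
    simp only [one_smul, zero_smul, add_zero] at h3
    rw [← h3]
    refine (enorm_intv_le _).trans (lintegral_mono fun t => ?_)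
    exact ContinuousLinearMap.le_opENorm _ _
  calc ∫⁻ x, ‖Y (x + w) - Y x‖ₑ ∂ν
      ≤ ∫⁻ x, (∫⁻ t in Set.Ioc (0:ℝ) 1, ‖fderiv ℝ Y (x + t • w)‖ₑ * ‖w‖ₑ) ∂ν := lintegral_mono key
    _ = ∫⁻ t in Set.Ioc (0:ℝ) 1, ∫⁻ x, ‖fderiv ℝ Y (x + t • w)‖ₑ * ‖w‖ₑ ∂ν := by
        rw [lintegral_lintegral_swap]
        refine Measurable.aemeasurable ?_
        have : Continuous (fun z : E × ℝ => fderiv ℝ Y (z.1 + z.2 • w)) := by fun_prop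
        exact this.enorm.measurable.mul_const _
    _ = ∫⁻ t in Set.Ioc (0:ℝ) 1, ‖w‖ₑ * ∫⁻ x, ‖fderiv ℝ Y x‖ₑ ∂ν := by
        refine lintegral_congr fun t => ?_
        rw [lintegral_mul_const _ (by fun_prop), mul_comm,
          lintegral_add_right_eq_self (fun x => ‖fderiv ℝ Y x‖ₑ) (t • w)]
    _ = _ := by simp

lemma TL2 {ν : Measure E} [ν.IsAddHaarMeasure] {q : E → ℝ} {Y : E → E} (hY : ContDiff ℝ 1 Y)
    (hq : ∀ x, HasFDerivAt q (innerSL ℝ (Y x)) x) (v : E) :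
    ∫⁻ x, ‖q (x + v) - q x - inner ℝ (Y x) v‖ₑ ∂ν ≤ ‖v‖ₑ ^ 2 * ∫⁻ x, ‖fderiv ℝ Y x‖ₑ ∂ν := by
  have hYc := hY.continuous
  have key : ∀ x, ‖q (x + v) - q x - inner ℝ (Y x) v‖ₑ
      ≤ ∫⁻ t in Set.Ioc (0:ℝ) 1, ‖Y (x + t • v) - Y x‖ₑ * ‖v‖ₑ := by
    intro x
    have h1 : ∀ t ∈ Set.uIcc (0:ℝ) 1, HasDerivAt (fun t : ℝ => q (x + t • v) - t * inner ℝ (Y x) v)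
        (inner ℝ (Y (x + t • v) - Y x) v) t := by
      intro t _
      have h2 : HasDerivAt (fun t : ℝ => x + t • v) v t := by
        simpa using ((hasDerivAt_id t).smul_const v).const_add x
      have h3 := (hq (x + t • v)).comp_hasDerivAt t h2
      have h4 := h3.sub ((hasDerivAt_id t).mul_const (inner ℝ (Y x) v))
      refine h4.congr_deriv ?_
      simp [inner_sub_left]
    have h3 := intervalIntegral.integral_eq_sub_of_hasDerivAt h1
      (Continuous.intervalIntegrable (by fun_prop) _ _)
    simp only [one_smul, zero_smul, add_zero, one_mul, zero_mul, sub_zero] at h3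
    rw [show q (x + v) - q x - inner ℝ (Y x) v = q (x + v) - inner ℝ (Y x) v - q x by ring, ← h3]
    refine (enorm_intv_le _).trans (lintegral_mono fun t => ?_)
    rw [← ofReal_norm, ← ofReal_norm, ← ofReal_norm, ← ENNReal.ofReal_mul (norm_nonneg _)]
    exact ENNReal.ofReal_le_ofReal (norm_inner_le_norm _ _)
  calc ∫⁻ x, ‖q (x + v) - q x - inner ℝ (Y x) v‖ₑ ∂ν
      ≤ ∫⁻ x, (∫⁻ t in Set.Ioc (0:ℝ) 1, ‖Y (x + t • v) - Y x‖ₑ * ‖v‖ₑ) ∂ν := lintegral_mono key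
    _ = ∫⁻ t in Set.Ioc (0:ℝ) 1, ∫⁻ x, ‖Y (x + t • v) - Y x‖ₑ * ‖v‖ₑ ∂ν := by
        rw [lintegral_lintegral_swap]
        refine Measurable.aemeasurable ?_
        have : Continuous (fun z : E × ℝ => Y (z.1 + z.2 • v) - Y z.1) := by fun_prop
        exact this.enorm.measurable.mul_const _
    _ ≤ ∫⁻ t in Set.Ioc (0:ℝ) 1, ‖v‖ₑ ^ 2 * ∫⁻ x, ‖fderiv ℝ Y x‖ₑ ∂ν := by
        refine setLIntegral_mono' measurableSet_Ioc fun t ht => ?_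
        rw [lintegral_mul_const _ (by fun_prop), mul_comm, sq, mul_assoc]
        gcongr
        refine (TL hY (t • v)).trans ?_
        gcongr
        rw [enorm_smul]
        refine mul_le_of_le_one_left' ?_
        rw [Real.enorm_of_nonneg ht.1.le]
        exact ENNReal.ofReal_le_one.2 ht.2
    _ = _ := by simp

lemma toReal_bound {ν : Measure E} {G G' : Type*} [NormedAddCommGroup G] [NormedAddCommGroup G']
    {f : E → G} {h : E → G'} (hf : AEStronglyMeasurable f ν) (hh : Integrable h ν) {c : ℝ} (hc : 0 ≤ c)
    (H : ∫⁻ x, ‖f x‖ₑ ∂ν ≤ ENNReal.ofReal c * ∫⁻ x, ‖h x‖ₑ ∂ν) :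
    Integrable f ν ∧ ∫ x, ‖f x‖ ∂ν ≤ c * ∫ x, ‖h x‖ ∂ν := by
  have ht : ENNReal.ofReal c * ∫⁻ x, ‖h x‖ₑ ∂ν < ∞ :=
    ENNReal.mul_lt_top ENNReal.ofReal_lt_top hh.2
  refine ⟨⟨hf, H.trans_lt ht⟩, ?_⟩
  rw [integral_norm_eq_lintegral_enorm hf, integral_norm_eq_lintegral_enorm hh.1]
  have := ENNReal.toReal_mono ht.ne H
  rwa [ENNReal.toReal_mul, ENNReal.toReal_ofReal hc] at this

/-- data of a nice density -/
structure ND (ν : Measure E) (q : E → ℝ) (Y : E → E) : Prop where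
  cd : ContDiff ℝ 1 Y
  hd : ∀ x, HasFDerivAt q (innerSL ℝ (Y x)) x
  iq : Integrable q ν
  iY : Integrable Y ν
  iD : Integrable (fderiv ℝ Y) ν

variable {ν : Measure E} {q : E → ℝ} {Y : E → E}

lemma ND.contq (h : ND ν q Y) : Continuous q :=
  continuous_iff_continuousAt.2 fun x => (h.hd x).continuousAt

lemma ND.T1 [ν.IsAddHaarMeasure] (h : ND ν q Y) (w : E) :
    Integrable (fun x => Y (x + w) - Y x) ν ∧
      ∫ x, ‖Y (x + w) - Y x‖ ∂ν ≤ ‖w‖ * ∫ x, ‖fderiv ℝ Y x‖ ∂ν := by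
  have hYc := h.cd.continuous
  refine toReal_bound (by fun_prop) h.iD (norm_nonneg _) ?_
  rw [ofReal_norm]
  exact TL h.cd w

lemma ND.T2 [ν.IsAddHaarMeasure] (h : ND ν q Y) (w : E) :
    Integrable (fun x => q (x + w) - q x - inner ℝ (Y x) w) ν ∧
      ∫ x, ‖q (x + w) - q x - inner ℝ (Y x) w‖ ∂ν ≤ ‖w‖ ^ 2 * ∫ x, ‖fderiv ℝ Y x‖ ∂ν := by
  have hYc := h.cd.continuous
  have hqc := h.contq
  refine toReal_bound (by fun_prop) h.iD (by positivity) ?_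
  rw [ENNReal.ofReal_pow (norm_nonneg _), ofReal_norm]
  exact TL2 h.cd h.hd w

lemma Good.bddmul {Λ : ℝ} {F : E → ℝ} (hF : Good Λ F) (hq : Integrable q ν) (w : E) :
    Integrable (fun x => F (x + w) * q x) ν := by
  obtain ⟨C, hC⟩ := hF.bdd
  have := hF.cont
  exact hq.bdd_mul (c := C) (by fun_prop) (.of_forall fun x => hC _)

lemma Good.Dmul {Λ : ℝ} {F : E → ℝ} (hF : Good Λ F) (hq : Integrable q ν) (w v : E) :
    Integrable (fun x => fderiv ℝ F (x + w) v * q x) ν := by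
  have := hF.contD
  exact hq.bdd_mul (c := Λ * ‖v‖) (by fun_prop) (.of_forall fun x => fderiv_apply_le hF _ _)

lemma A2w [ν.IsAddHaarMeasure] (h : ND ν q Y) {Λ : ℝ} {F : E → ℝ} (hF : Good Λ F) (w : E) :
    |∫ x, F (x + w) * q x ∂ν - ∫ x, F x * q x ∂ν - ∫ x, fderiv ℝ F x w * q x ∂ν
      + 1 / 2 * ∫ x, fderiv ℝ F x w * inner ℝ (Y x) w ∂ν|
      ≤ Λ * ‖w‖ ^ 3 * ∫ x, ‖fderiv ℝ Y x‖ ∂ν := by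
  have hΛ := hF.nonneg
  have hc := hF.cont
  have hcD := hF.contD
  have hqc := h.contq
  have hYc := h.cd.continuous
  have hd : ∀ r : ℝ, HasDerivAt (fun r : ℝ => ∫ x, F (x + r • w) * q x ∂ν)
      (∫ x, fderiv ℝ F (x + r • w) w * q x ∂ν) r := by
    intro r
    refine (hasDerivAt_integral_of_dominated_loc_of_deriv_le (s := Set.univ)
      (bound := fun x => Λ * ‖w‖ * ‖q x‖)
      (F := fun r x => F (x + r • w) * q x) (F' := fun r x => fderiv ℝ F (x + r • w) w * q x)
      Filter.univ_mem (.of_forall fun y => ?_) (hF.bddmul h.iq _) ?_ ?_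
      (h.iq.norm.const_mul _) (.of_forall fun x y _ => ?_)).2
    · fun_prop
    · fun_prop
    · refine .of_forall fun x y _ => ?_
      rw [norm_mul]
      gcongr
      exact fderiv_apply_le hF _ _
    · have h2 : HasDerivAt (fun t : ℝ => x + t • w) w y := by
        simpa using ((hasDerivAt_id y).smul_const w).const_add x
      exact ((hF.hasFDeriv (x + y • w)).comp_hasDerivAt y h2).mul_const _
  set c := ∫ x, fderiv ℝ F x w * inner ℝ (Y x) w ∂ν with hcdef
  set d := ∫ x, fderiv ℝ F x w * q x ∂ν with hddef
  set B := ∫ x, ‖fderiv ℝ Y x‖ ∂ν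
  have iw : ∀ v : E, Integrable (fun x => inner ℝ (Y x) v) ν := fun v => h.iY.inner_const v
  have ic : Integrable (fun x => fderiv ℝ F x w * inner ℝ (Y x) w) ν := by
    simpa using hF.Dmul (iw w) 0 w
  have id' : Integrable (fun x => fderiv ℝ F x w * q x) ν := by
    simpa using hF.Dmul h.iq 0 w
  have tr : ∀ r : ℝ, ∫ x, fderiv ℝ F (x + r • w) w * q x ∂ν
      = ∫ x, fderiv ℝ F x w * q (x + (-r) • w) ∂ν := by
    intro r
    rw [← integral_add_right_eq_self (fun x => fderiv ℝ F x w * q (x + (-r) • w)) (r • w)]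
    simp [add_assoc]
  have bd : ∀ r ∈ Set.Ico (0:ℝ) 1, ‖∫ x, fderiv ℝ F (x + r • w) w * q x ∂ν - d + r * c‖ ≤ Λ * ‖w‖ ^ 3 * B := by
    intro r hr
    obtain ⟨i2, hb⟩ := h.T2 ((-r) • w)
    have it : Integrable (fun x => fderiv ℝ F x w * q (x + (-r) • w)) ν := by
      have : Integrable (fun x => q (x + (-r) • w)) ν := h.iq.comp_add_right _
      simpa using hF.Dmul this 0 w
    have e : ∫ x, fderiv ℝ F (x + r • w) w * q x ∂ν - d + r * c
        = ∫ x, fderiv ℝ F x w * (q (x + (-r) • w) - q x - inner ℝ (Y x) ((-r) • w)) ∂ν := by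
      rw [tr, hddef, hcdef, ← integral_const_mul, ← integral_sub it id',
        ← integral_add (it.sub' id') (ic.const_mul _)]
      refine integral_congr_ae (.of_forall fun x => ?_)
      simp only [inner_smul_right]
      ring
    rw [e]
    calc _ ≤ ∫ x, ‖fderiv ℝ F x w * (q (x + (-r) • w) - q x - inner ℝ (Y x) ((-r) • w))‖ ∂ν :=
          norm_integral_le_integral_norm _
      _ ≤ ∫ x, Λ * ‖w‖ * ‖q (x + (-r) • w) - q x - inner ℝ (Y x) ((-r) • w)‖ ∂ν := by
          refine integral_mono_of_nonneg (.of_forall fun x => norm_nonneg _) (i2.norm.const_mul _)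
            (.of_forall fun x => ?_)
          simp only [norm_mul]
          gcongr
          exact fderiv_apply_le hF _ _
      _ = Λ * ‖w‖ * ∫ x, ‖q (x + (-r) • w) - q x - inner ℝ (Y x) ((-r) • w)‖ ∂ν := integral_const_mul _ _
      _ ≤ Λ * ‖w‖ * (‖(-r) • w‖ ^ 2 * B) := by gcongr
      _ ≤ Λ * ‖w‖ * (‖w‖ ^ 2 * B) := by
          have : ‖(-r) • w‖ ≤ ‖w‖ := by
            rw [norm_smul, norm_neg, Real.norm_of_nonneg hr.1]
            exact mul_le_of_le_one_left (norm_nonneg _) hr.2.le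
          have hB : 0 ≤ B := integral_nonneg fun x => norm_nonneg _
          gcongr
      _ = _ := by ring
  have fin := norm_image_sub_le_of_norm_deriv_le_segment_01'
    (f := fun r : ℝ => ∫ x, F (x + r • w) * q x ∂ν - r * d + r ^ 2 / 2 * c)
    (f' := fun r => ∫ x, fderiv ℝ F (x + r • w) w * q x ∂ν - d + r * c)
    (C := Λ * ‖w‖ ^ 3 * B) (fun r _ => ?_) bd
  · simp only [one_smul, zero_smul, add_zero, Real.norm_eq_abs] at fin
    convert fin using 2
    ring
  · refine HasDerivAt.hasDerivWithinAt ?_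
    have h1 := ((hd r).sub ((hasDerivAt_id r).mul_const d)).add
      ((((hasDerivAt_id r).pow 2).div_const 2).mul_const c)
    refine h1.congr_deriv ?_
    simp

end BLM

namespace BLM
open MeasureTheory ProbabilityTheory
open scoped ENNReal
set_option linter.unusedSectionVars false
set_option linter.unusedVariables false

variable {E : Type*} [NormedAddCommGroup E] [InnerProductSpace ℝ E] [FiniteDimensional ℝ E]
  [MeasurableSpace E] [BorelSpace E]
variable {ν : Measure E} {q : E → ℝ} {Y : E → E}

lemma g_lin (l : E →L[ℝ] ℝ) : ∫ g : E, l g ∂(stdGaussian E) = 0 := by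
  rw [← g_mean ((InnerProductSpace.toDual ℝ E).symm l)]
  simp [InnerProductSpace.toDual_symm_apply]

lemma g_lin2 (l : E →L[ℝ] ℝ) (v : E) : ∫ g : E, l g * inner ℝ v g ∂(stdGaussian E) = l v := by
  have := g_inner ((InnerProductSpace.toDual ℝ E).symm l) v
  simpa [InnerProductSpace.toDual_symm_apply] using this

lemma A2 [ν.IsAddHaarMeasure] (h : ND ν q Y) {Λ : ℝ} {F : E → ℝ} (hF : Good Λ F) {σ : ℝ} (hσ : 0 ≤ σ) :
    |∫ x, Hs σ F x * q x ∂ν - ∫ x, F x * q x ∂ν + σ ^ 2 / 2 * ∫ x, fderiv ℝ F x (Y x) ∂ν|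
      ≤ Λ * σ ^ 3 * (∫ g : E, ‖g‖ ^ 3 ∂(stdGaussian E)) * ∫ x, ‖fderiv ℝ Y x‖ ∂ν := by
  have hΛ := hF.nonneg
  have hc := hF.cont
  have hcD := hF.contD
  have hqc := h.contq
  have hYc := h.cd.continuous
  obtain ⟨C, hC⟩ := hF.bdd
  set B := ∫ x, ‖fderiv ℝ Y x‖ ∂ν
  set γ := stdGaussian E
  have ia : Integrable (fun z : E × E => F (z.1 + σ • z.2) * q z.1) (ν.prod γ) := by
    have : Integrable (fun z : E × E => q z.1) (ν.prod γ) := h.iq.comp_fst γ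
    exact this.bdd_mul (c := C) (by fun_prop) (.of_forall fun x => hC _)
  have ib : Integrable (fun z : E × E => fderiv ℝ F z.1 (σ • z.2) * q z.1) (ν.prod γ) := by
    have : Integrable (fun z : E × E => ‖q z.1‖ * ‖z.2‖) (ν.prod γ) := h.iq.norm.mul_prod g_int_norm
    refine (this.const_mul (Λ * σ)).mono' (by fun_prop) (.of_forall fun z => ?_)
    rw [norm_mul]
    calc _ ≤ Λ * ‖σ • z.2‖ * ‖q z.1‖ := by gcongr; exact fderiv_apply_le hF _ _
      _ = _ := by rw [norm_smul, Real.norm_of_nonneg hσ]; ring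
  have ic : Integrable (fun z : E × E => fderiv ℝ F z.1 (σ • z.2) * inner ℝ (Y z.1) (σ • z.2)) (ν.prod γ) := by
    have : Integrable (fun z : E × E => ‖Y z.1‖ * ‖z.2‖ ^ 2) (ν.prod γ) := h.iY.norm.mul_prod (g_int_pow 2)
    refine (this.const_mul (Λ * σ ^ 2)).mono' (by fun_prop) (.of_forall fun z => ?_)
    rw [norm_mul]
    calc _ ≤ (Λ * ‖σ • z.2‖) * (‖Y z.1‖ * ‖σ • z.2‖) := by
          gcongr
          · exact fderiv_apply_le hF _ _
          · exact norm_inner_le_norm _ _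
      _ = _ := by rw [norm_smul, Real.norm_of_nonneg hσ]; ring
  have ea : ∫ g, ∫ x, F (x + σ • g) * q x ∂ν ∂γ = ∫ x, Hs σ F x * q x ∂ν := by
    rw [← integral_integral_swap ia]
    refine integral_congr_ae (.of_forall fun x => ?_)
    simp only [Hs, integral_mul_const]
    rfl
  have eb : ∫ g, ∫ x, fderiv ℝ F x (σ • g) * q x ∂ν ∂γ = 0 := by
    rw [← integral_integral_swap ib]
    simp only [integral_mul_const, map_smul, smul_eq_mul, integral_const_mul]
    simp [γ, g_lin]
  have ec : ∫ g, ∫ x, fderiv ℝ F x (σ • g) * inner ℝ (Y x) (σ • g) ∂ν ∂γ = σ ^ 2 * ∫ x, fderiv ℝ F x (Y x) ∂ν := by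
    rw [← integral_integral_swap ic, ← integral_const_mul]
    refine integral_congr_ae (.of_forall fun x => ?_)
    simp only [map_smul, smul_eq_mul, inner_smul_right]
    rw [← g_lin2, ← integral_const_mul]
    refine integral_congr_ae (.of_forall fun g => ?_)
    simp only
    ring
  have ja := ia.integral_prod_right
  have jb := ib.integral_prod_right
  have jc := ic.integral_prod_right
  have e : ∫ x, Hs σ F x * q x ∂ν - ∫ x, F x * q x ∂ν + σ ^ 2 / 2 * ∫ x, fderiv ℝ F x (Y x) ∂ν
      = ∫ g, (∫ x, F (x + σ • g) * q x ∂ν - ∫ x, F x * q x ∂ν - ∫ x, fderiv ℝ F x (σ • g) * q x ∂ν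
      + 1 / 2 * ∫ x, fderiv ℝ F x (σ • g) * inner ℝ (Y x) (σ • g) ∂ν) ∂γ := by
    rw [integral_add ((ja.sub' (integrable_const _)).sub' jb) (jc.const_mul _),
      integral_sub (ja.sub' (integrable_const _)) jb, integral_sub ja (integrable_const _),
      integral_const_mul, ea, eb, ec]
    simp
    ring
  rw [e]
  calc _ ≤ ∫ g, |∫ x, F (x + σ • g) * q x ∂ν - ∫ x, F x * q x ∂ν - ∫ x, fderiv ℝ F x (σ • g) * q x ∂ν
      + 1 / 2 * ∫ x, fderiv ℝ F x (σ • g) * inner ℝ (Y x) (σ • g) ∂ν| ∂γ := abs_integral_le_integral_abs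
    _ ≤ ∫ g : E, Λ * σ ^ 3 * B * ‖g‖ ^ 3 ∂γ := by
        refine integral_mono_of_nonneg (.of_forall fun x => abs_nonneg _) ((g_int_pow 3).const_mul _)
            (.of_forall fun g => ?_)
        refine (A2w h hF (σ • g)).trans (le_of_eq ?_)
        rw [norm_smul, Real.norm_of_nonneg hσ]; ring
    _ = _ := by rw [integral_const_mul]; ring

lemma A1b [ν.IsAddHaarMeasure] (h : ND ν q Y) {Λ : ℝ} {F : E → ℝ} (hF : Good Λ F) {σ : ℝ} (hσ : 0 ≤ σ) :
    |∫ x, fderiv ℝ (Hs σ F) x (Y x) ∂ν - ∫ x, fderiv ℝ F x (Y x) ∂ν|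
      ≤ Λ * σ * (∫ g : E, ‖g‖ ∂(stdGaussian E)) * ∫ x, ‖fderiv ℝ Y x‖ ∂ν := by
  have hΛ := hF.nonneg
  have hc := hF.cont
  have hcD := hF.contD
  have hYc := h.cd.continuous
  set B := ∫ x, ‖fderiv ℝ Y x‖ ∂ν
  set γ := stdGaussian E
  have ia : Integrable (fun z : E × E => fderiv ℝ F (z.1 + σ • z.2) (Y z.1)) (ν.prod γ) := by
    have : Integrable (fun z : E × E => Y z.1) (ν.prod γ) := h.iY.comp_fst γ
    refine (this.norm.const_mul Λ).mono' (by fun_prop) (.of_forall fun z => fderiv_apply_le hF _ _)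
  have ea : ∫ x, fderiv ℝ (Hs σ F) x (Y x) ∂ν = ∫ g, ∫ x, fderiv ℝ F (x + σ • g) (Y x) ∂ν ∂γ := by
    rw [← integral_integral_swap ia]
    refine integral_congr_ae (.of_forall fun x => ?_)
    simp only
    rw [(Hs_hasFDeriv hF x).fderiv, ContinuousLinearMap.integral_apply (hF.intD_shift x)]
  have ja := ia.integral_prod_right
  have dm : ∀ Z : E → E, Continuous Z → Integrable Z ν → Integrable (fun x => fderiv ℝ F x (Z x)) ν :=
    fun Z hZ hi => (hi.norm.const_mul Λ).mono' (by fun_prop) (.of_forall fun z => fderiv_apply_le hF _ _)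
  have e : ∫ x, fderiv ℝ (Hs σ F) x (Y x) ∂ν - ∫ x, fderiv ℝ F x (Y x) ∂ν
      = ∫ g, (∫ x, fderiv ℝ F (x + σ • g) (Y x) ∂ν - ∫ x, fderiv ℝ F x (Y x) ∂ν) ∂γ := by
    rw [integral_sub ja (integrable_const _), ea]
    simp
  rw [e]
  calc _ ≤ ∫ g, |∫ x, fderiv ℝ F (x + σ • g) (Y x) ∂ν - ∫ x, fderiv ℝ F x (Y x) ∂ν| ∂γ :=
        abs_integral_le_integral_abs
    _ ≤ ∫ g : E, Λ * σ * B * ‖g‖ ∂γ := by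
        refine integral_mono_of_nonneg (.of_forall fun x => abs_nonneg _) (g_int_norm.const_mul _)
            (.of_forall fun g => ?_)
        simp only
        obtain ⟨i1, hb⟩ := h.T1 (-(σ • g))
        rw [show ∫ x, fderiv ℝ F (x + σ • g) (Y x) ∂ν = ∫ x, fderiv ℝ F x (Y (x + -(σ • g))) ∂ν by
          rw [← integral_add_right_eq_self (fun x => fderiv ℝ F x (Y (x + -(σ • g)))) (σ • g)]
          simp [add_assoc],
          ← integral_sub (dm _ (by fun_prop) (h.iY.comp_add_right _)) (dm _ hYc h.iY)]
        simp only [← map_sub]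
        refine abs_integral_le_integral_abs.trans ?_
        calc _ ≤ ∫ x, Λ * ‖Y (x + -(σ • g)) - Y x‖ ∂ν :=
              integral_mono_of_nonneg (.of_forall fun x => abs_nonneg _) (i1.norm.const_mul _)
                (.of_forall fun x => fderiv_apply_le hF _ _)
          _ = Λ * ∫ x, ‖Y (x + -(σ • g)) - Y x‖ ∂ν := integral_const_mul _ _
          _ ≤ Λ * (‖-(σ • g)‖ * B) := by gcongr
          _ = _ := by rw [norm_neg, norm_smul, Real.norm_of_nonneg hσ]; ring
    _ = _ := by rw [integral_const_mul]; ring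

lemma taylor {H : E → ℝ} (hd : Differentiable ℝ H) {K : ℝ} (hK : 0 ≤ K)
    (hl : ∀ x y, ‖fderiv ℝ H x - fderiv ℝ H y‖ ≤ K * ‖x - y‖) (x v : E) :
    |H (x + v) - H x - fderiv ℝ H x v| ≤ K * ‖v‖ ^ 2 := by
  have := (convex_closedBall x ‖v‖).norm_image_sub_le_of_norm_hasFDerivWithin_le'
    (f := H) (f' := fderiv ℝ H) (φ := fderiv ℝ H x) (C := K * ‖v‖) (x := x) (y := x + v)
    (fun y _ => (hd y).hasFDerivAt.hasFDerivWithinAt)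
    (fun y hy => (hl y x).trans (by
      gcongr
      simpa [dist_eq_norm] using hy)) (by simp) (by simp)
  simp only [add_sub_cancel_left, Real.norm_eq_abs] at this
  refine this.trans (le_of_eq (by ring))

lemma A1a {W : E → E} (hq0 : ∀ x, 0 ≤ q x) (hqc : Continuous q) (hW : Continuous W)
    (hYW : ∀ x, Y x = -(q x • W x)) (iq : Integrable q ν) (iY : Integrable Y ν)
    (iW : Integrable (fun x => ‖W x‖ ^ 2 * q x) ν) {Λ : ℝ} {F : E → ℝ} (hF : Good Λ F) {σ s : ℝ} (hσ : 0 < σ) :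
    |∫ x, Hs σ F (x - s • W x) * q x ∂ν - ∫ x, Hs σ F x * q x ∂ν - s * ∫ x, fderiv ℝ (Hs σ F) x (Y x) ∂ν|
      ≤ (Λ / σ * ∫ g : E, ‖g‖ ∂(stdGaussian E)) * s ^ 2 * ∫ x, ‖W x‖ ^ 2 * q x ∂ν := by
  have hΛ := hF.nonneg
  have hH := Hs_good (σ := σ) hF
  set K := Λ / σ * ∫ g : E, ‖g‖ ∂(stdGaussian E)
  have hK : 0 ≤ K := by
    have : 0 ≤ ∫ g : E, ‖g‖ ∂(stdGaussian E) := integral_nonneg fun g => norm_nonneg _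
    positivity
  have hl : ∀ x y, ‖fderiv ℝ (Hs σ F) x - fderiv ℝ (Hs σ F) y‖ ≤ K * ‖x - y‖ := Hs_fderiv_lip hF hσ
  set H := Hs σ F
  have hHc := hH.cont
  have hHD := hH.contD
  have hYc : Continuous Y := by
    rw [funext hYW]; fun_prop
  obtain ⟨C, hC⟩ := hH.bdd
  have i1 : Integrable (fun x => H (x - s • W x) * q x) ν :=
    iq.bdd_mul (c := C) (by fun_prop) (.of_forall fun x => hC _)
  have i2 : Integrable (fun x => H x * q x) ν :=
    iq.bdd_mul (c := C) (by fun_prop) (.of_forall fun x => hC _)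
  have i3 : Integrable (fun x => s * fderiv ℝ H x (Y x)) ν :=
    ((iY.norm.const_mul Λ).mono' (by fun_prop) (.of_forall fun z => fderiv_apply_le hH _ _)).const_mul s
  rw [← integral_sub i1 i2, ← integral_const_mul, ← integral_sub (i1.sub' i2) i3, ← integral_const_mul]
  refine abs_integral_le_integral_abs.trans ?_
  refine integral_mono_of_nonneg (.of_forall fun x => abs_nonneg _) (iW.const_mul _)
    (.of_forall fun x => ?_)
  simp only
  have ht := taylor hH.diff hK hl x (-(s • W x))
  have e : H (x - s • W x) * q x - H x * q x - s * fderiv ℝ H x (Y x)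
      = (H (x + -(s • W x)) - H x - fderiv ℝ H x (-(s • W x))) * q x := by
    rw [hYW, ← sub_eq_add_neg]
    simp only [map_neg, map_smul, smul_eq_mul]
    ring
  rw [e, abs_mul, abs_of_nonneg (hq0 x)]
  calc _ ≤ K * ‖-(s • W x)‖ ^ 2 * q x := by gcongr; exact hq0 x
    _ = _ := by rw [norm_neg, norm_smul, mul_pow, Real.norm_eq_abs, sq_abs]; ring

end BLM

namespace BLM
open MeasureTheory ProbabilityTheory
open scoped ENNReal
set_option linter.unusedSectionVars false
set_option linter.unusedVariables false

variable {E : Type*} [NormedAddCommGroup E] [InnerProductSpace ℝ E] [FiniteDimensional ℝ E]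
  [MeasurableSpace E] [BorelSpace E]

lemma int_poly (ν : Measure E) [ν.IsAddHaarMeasure] (k : ℕ) {a : ℝ} (ha : 0 < a) :
    Integrable (fun x : E => (1 + ‖x‖) ^ k * Real.exp (-(a * ‖x‖))) ν := by
  set d := Module.finrank ℝ E with hd
  have h := integrable_one_add_norm (E := E) (μ := ν) (r := ((d + 1 : ℕ) : ℝ)) (by
    push_cast; rw [← hd]; linarith)
  set N := k + (d + 1)
  refine (h.const_mul ((N.factorial : ℝ) / a ^ N * Real.exp a)).mono' (by fun_prop)
    (.of_forall fun x => ?_)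
  have h1 : 0 < 1 + ‖x‖ := by positivity
  rw [Real.norm_of_nonneg (by positivity), Real.rpow_neg h1.le, Real.rpow_natCast]
  have h2 := Real.pow_div_factorial_le_exp (a * (1 + ‖x‖)) (by positivity) N
  have h3 : Real.exp (a * (1 + ‖x‖)) = Real.exp a * Real.exp (a * ‖x‖) := by
    rw [← Real.exp_add]; ring_nf
  rw [h3, div_le_iff₀ (by positivity), mul_pow] at h2
  rw [← div_eq_mul_inv, le_div_iff₀ (by positivity), Real.exp_neg]
  have h4 := Real.exp_pos (a * ‖x‖)
  rw [show (1 + ‖x‖) ^ k * (Real.exp (a * ‖x‖))⁻¹ * (1 + ‖x‖) ^ (d + 1)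
    = (1 + ‖x‖) ^ N / Real.exp (a * ‖x‖) by simp only [N, pow_add]; field_simp, div_le_iff₀ h4,
    show (N.factorial : ℝ) / a ^ N * Real.exp a * Real.exp (a * ‖x‖)
      = (Real.exp a * Real.exp (a * ‖x‖) * N.factorial) / a ^ N by ring, le_div_iff₀ (by positivity)]
  linarith

structure NP (V : E → ℝ) (W : E → E) (L lam : ℝ) : Prop where
  hV : ∀ x, HasFDerivAt V (innerSL ℝ (W x)) x
  cd : ContDiff ℝ 1 W
  le : ∀ x, ‖fderiv ℝ W x‖ ≤ L
  mono : ∀ x y, lam * ‖x - y‖ ^ 2 ≤ inner ℝ (W x - W y) (x - y)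
  dec : ∃ C a, 0 < a ∧ ∀ x, Real.exp (-V x) ≤ C * Real.exp (-(a * ‖x‖))

variable {V : E → ℝ} {W : E → E} {L lam : ℝ}

lemma NP.contV (h : NP V W L lam) : Continuous V :=
  continuous_iff_continuousAt.2 fun x => (h.hV x).continuousAt

lemma NP.int (h : NP V W L lam) (ν : Measure E) [ν.IsAddHaarMeasure] (k : ℕ) :
    Integrable (fun x => (1 + ‖x‖) ^ k * Real.exp (-V x)) ν := by
  obtain ⟨C, a, ha, hC⟩ := h.dec
  have := h.contV
  refine ((int_poly ν k ha).const_mul C).mono' (by fun_prop) (.of_forall fun x => ?_)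
  rw [Real.norm_of_nonneg (by positivity)]
  have := mul_le_mul_of_nonneg_left (hC x) (show 0 ≤ (1 + ‖x‖) ^ k by positivity)
  linarith

lemma NP.lipW (h : NP V W L lam) (x y : E) : ‖W x - W y‖ ≤ L * ‖x - y‖ :=
  Convex.norm_image_sub_le_of_norm_fderiv_le (s := Set.univ)
    (fun x _ => h.cd.differentiable (by norm_num) x) (fun x _ => h.le x) convex_univ trivial trivial

lemma NP.L0 (h : NP V W L lam) : 0 ≤ L := (norm_nonneg _).trans (h.le 0)

lemma NP.grow (h : NP V W L lam) : ∃ A, 0 ≤ A ∧ ∀ x, ‖W x‖ ≤ A * (1 + ‖x‖) := by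
  have hL := h.L0
  refine ⟨‖W 0‖ + L, by positivity, fun x => ?_⟩
  have h1 := h.lipW x 0
  have h2 := norm_le_norm_sub_add (W x) (W 0)
  rw [sub_zero] at h1
  nlinarith [norm_nonneg x, norm_nonneg (W 0)]

lemma NP.iW (h : NP V W L lam) (ν : Measure E) [ν.IsAddHaarMeasure] (k : ℕ) :
    Integrable (fun x => ‖W x‖ ^ k * Real.exp (-V x)) ν := by
  obtain ⟨A, hA, hW⟩ := h.grow
  have := h.contV
  have hWc := h.cd.continuous
  refine ((h.int ν k).const_mul (A ^ k)).mono' (by fun_prop) (.of_forall fun x => ?_)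
  rw [Real.norm_of_nonneg (by positivity), ← mul_assoc, ← mul_pow]
  gcongr
  exact hW x

lemma NP.nd (h : NP V W L lam) (ν : Measure E) [ν.IsAddHaarMeasure] :
    ND ν (fun x => Real.exp (-V x)) (fun x => -(Real.exp (-V x) • W x)) := by
  have hVc := h.contV
  have hWc := h.cd.continuous
  have hL := h.L0
  have hWD : Continuous (fderiv ℝ W) := h.cd.continuous_fderiv (by norm_num)
  have hVcd : ContDiff ℝ 1 V := by
    rw [contDiff_one_iff_fderiv]
    refine ⟨fun x => (h.hV x).differentiableAt, ?_⟩
    rw [show fderiv ℝ V = fun x => innerSL ℝ (W x) from funext fun x => (h.hV x).fderiv]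
    fun_prop
  have hqd : ∀ x, HasFDerivAt (fun x => Real.exp (-V x)) (innerSL ℝ (-(Real.exp (-V x) • W x))) x := by
    intro x
    have := (h.hV x).neg.exp
    refine this.congr_fderiv ?_
    ext v
    simp
  have hYd : ∀ x, HasFDerivAt (fun x => -(Real.exp (-V x) • W x))
      (-(Real.exp (-V x) • fderiv ℝ W x + (innerSL ℝ (-(Real.exp (-V x) • W x))).smulRight (W x))) x :=
    fun x => ((hqd x).smul (h.cd.differentiable (by norm_num) x).hasFDerivAt).neg
  have hcd : ContDiff ℝ 1 (fun x => -(Real.exp (-V x) • W x)) :=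
    ((Real.contDiff_exp.comp hVcd.neg).smul h.cd).neg
  refine ⟨hcd, hqd, ?_, ?_, ?_⟩
  · simpa using h.int ν 0
  · refine (h.iW ν 1).mono' (by fun_prop) (.of_forall fun x => ?_)
    rw [norm_neg, norm_smul, Real.norm_of_nonneg (by positivity), pow_one, mul_comm]
  · refine (((h.int ν 0).const_mul L).add (h.iW ν 2)).mono'
      (hcd.continuous_fderiv (by norm_num)).aestronglyMeasurable (.of_forall fun x => ?_)
    rw [(hYd x).fderiv, norm_neg]
    refine (norm_add_le _ _).trans ?_
    rw [ContinuousLinearMap.norm_smulRight_apply, innerSL_apply_norm, norm_neg, norm_smul, norm_smul,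
      Real.norm_of_nonneg (by positivity)]
    simp only [Pi.add_apply, pow_zero, one_mul]
    have := mul_le_mul_of_nonneg_left (h.le x) (Real.exp_pos (-V x)).le
    nlinarith

lemma NP.contr (h : NP V W L lam) (hlam : 0 < lam) {s : ℝ} (hs : 0 < s) (h1 : s * L ^ 2 ≤ lam)
    (h2 : s * lam ≤ 1) : Contr (√(1 - s * lam)) (fun x => x - s • W x) := by
  refine ⟨contDiff_id.sub (contDiff_const.smul h.cd), fun x => ?_⟩
  refine norm_fderiv_le_of_lip' ℝ (Real.sqrt_nonneg _) (.of_forall fun y => ?_)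
  refine le_of_sq_le_sq ?_ (by positivity)
  rw [mul_pow, Real.sq_sqrt (by linarith), show y - s • W y - (x - s • W x) = (y - x) - s • (W y - W x) by
    rw [smul_sub]; abel, norm_sub_sq_real, inner_smul_right, real_inner_comm, norm_smul, mul_pow,
    Real.norm_of_nonneg hs.le]
  have a1 := h.mono y x
  have a2 := pow_le_pow_left₀ (norm_nonneg _) (h.lipW y x) 2
  rw [mul_pow] at a2
  have a3 := mul_le_mul_of_nonneg_left a1 hs.le
  have a4 := mul_le_mul_of_nonneg_left a2 (sq_nonneg s)
  have a5 := mul_le_mul_of_nonneg_right h1 (show 0 ≤ s * ‖y - x‖ ^ 2 by positivity)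
  nlinarith

noncomputable def wd (ν : Measure E) (V : E → ℝ) : Measure E :=
  ν.withDensity (fun x => ENNReal.ofReal (Real.exp (-V x)))

lemma wd_integral {ν : Measure E} (hV : Continuous V) (f : E → ℝ) :
    ∫ x, f x ∂(wd ν V) = ∫ x, f x * Real.exp (-V x) ∂ν := by
  rw [wd, integral_withDensity_eq_integral_toReal_smul (by fun_prop) (by simp)]
  refine integral_congr_ae (.of_forall fun x => ?_)
  simp only [smul_eq_mul, ENNReal.toReal_ofReal (Real.exp_pos _).le]
  ring

lemma wd_integrable {ν : Measure E} (hV : Continuous V) (f : E → ℝ) :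
    Integrable f (wd ν V) ↔ Integrable (fun x => f x * Real.exp (-V x)) ν := by
  rw [wd, integrable_withDensity_iff (by fun_prop) (by simp)]
  simp only [ENNReal.toReal_ofReal (Real.exp_pos _).le]

lemma NP.im (h : NP V W L lam) (ν : Measure E) [ν.IsAddHaarMeasure] :
    Integrable (fun x => ‖x‖) (wd ν V) := by
  rw [wd_integrable h.contV]
  have := h.contV
  refine (h.int ν 1).mono' (by fun_prop) (.of_forall fun x => ?_)
  rw [Real.norm_of_nonneg (by positivity), pow_one]
  gcongr
  linarith

lemma NP.chain (h : NP V W L lam) (hlam : 0 < lam) (ν : Measure E) [ν.IsAddHaarMeasure] :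
    ∃ C s0, 0 < s0 ∧ ChainOK (wd ν V) lam C s0 := by
  have hVc := h.contV
  have hWc := h.cd.continuous
  have hL := h.L0
  have nd := h.nd ν
  set q := fun x => Real.exp (-V x) with hq
  set Y := fun x => -(Real.exp (-V x) • W x) with hY
  set B := ∫ x, ‖fderiv ℝ Y x‖ ∂ν
  set M2 := ∫ x, ‖W x‖ ^ 2 * q x ∂ν
  set M1 := ∫ x, ‖W x‖ * q x ∂ν
  set m1 := ∫ g : E, ‖g‖ ∂(stdGaussian E)
  set m3 := ∫ g : E, ‖g‖ ^ 3 ∂(stdGaussian E)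
  have hB : 0 ≤ B := integral_nonneg fun x => norm_nonneg _
  have hM2 : 0 ≤ M2 := integral_nonneg fun x => by simp only [hq]; positivity
  have hM1 : 0 ≤ M1 := integral_nonneg fun x => by simp only [hq]; positivity
  have hm1 : 0 ≤ m1 := integral_nonneg fun x => norm_nonneg _
  have hm3 : 0 ≤ m3 := integral_nonneg fun x => by positivity
  have iM1 : Integrable (fun x => ‖W x‖ * q x) ν := by simpa using h.iW ν 1
  refine ⟨m1 * M2 + 2 * m1 * B + 4 * m3 * B + M1, lam / (L ^ 2 + lam ^ 2 + 1), by positivity, ?_⟩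
  intro s hs hs0
  rw [lt_div_iff₀ (by positivity)] at hs0
  have c1 : s * L ^ 2 ≤ lam := by nlinarith [mul_pos hs (pow_pos hlam 2)]
  have c2 : s * lam ≤ 1 := by
    by_contra hcon
    push Not at hcon
    nlinarith [mul_nonneg hs.le (sq_nonneg L)]
  have e0 : ∀ x, ‖x - s • W x - x‖ = s * ‖W x‖ := fun x => by
    rw [sub_sub_cancel_left, norm_neg, norm_smul, Real.norm_of_nonneg hs.le]
  refine ⟨fun x => x - s • W x, h.contr hlam hs c1 c2, ?_, ?_, ?_⟩
  · intro Λ F hF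
    have hΛ := hF.nonneg
    rw [wd_integral hVc, wd_integral hVc]
    have hσ : 0 < √(2 * s) := Real.sqrt_pos.2 (by positivity)
    have hσ2 : √(2 * s) ^ 2 = 2 * s := Real.sq_sqrt (by positivity)
    have ht2 : √s ^ 2 = s := Real.sq_sqrt hs.le
    have ht : 0 < √s := Real.sqrt_pos.2 hs
    have hσt : √s ≤ √(2 * s) := Real.sqrt_le_sqrt (by linarith)
    have hσt2 : √(2 * s) ≤ 2 * √s := by nlinarith
    have a1 := A1a (q := q) (Y := Y) (fun x => (Real.exp_pos _).le) nd.contq hWc (fun x => rfl) nd.iq nd.iY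
      (h.iW ν 2) hF (s := s) hσ
    have a2 := A1b nd hF hσ.le
    have a3 := A2 nd hF hσ.le
    have es : ∫ x, Qs (fun x => x - s • W x) (√(2 * s)) F x * Real.exp (-V x) ∂ν
      = ∫ x, Hs (√(2 * s)) F (x - s • W x) * q x ∂ν := rfl
    rw [es]
    rw [hσ2] at a3
    set t := √s
    set σ := √(2 * s)
    set I1 := ∫ x, Hs σ F (x - s • W x) * q x ∂ν
    set I2 := ∫ x, Hs σ F x * q x ∂ν
    set I3 := ∫ x, F x * q x ∂ν
    set D1 := ∫ x, fderiv ℝ (Hs σ F) x (Y x) ∂ν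
    set D2 := ∫ x, fderiv ℝ F x (Y x) ∂ν
    have a2' : |s * D1 - s * D2| ≤ s * (Λ * σ * m1 * B) := by
      rw [← mul_sub, abs_mul, abs_of_pos hs]; gcongr
    have b1 : Λ / σ * m1 * s ^ 2 * M2 ≤ Λ * (m1 * M2) * (s * t) := by
      have : Λ / σ * s ≤ Λ * t := by
        rw [div_mul_eq_mul_div, div_le_iff₀ hσ, mul_assoc]
        gcongr
        nlinarith
      calc Λ / σ * m1 * s ^ 2 * M2 = (Λ / σ * s) * (m1 * M2 * s) := by ring
        _ ≤ (Λ * t) * (m1 * M2 * s) := by gcongr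
        _ = _ := by ring
    have b2 : s * (Λ * σ * m1 * B) ≤ Λ * (2 * m1 * B) * (s * t) := by
      calc s * (Λ * σ * m1 * B) ≤ s * (Λ * (2 * t) * m1 * B) := by gcongr
        _ = _ := by ring
    have b3 : Λ * σ ^ 3 * m3 * B ≤ Λ * (4 * m3 * B) * (s * t) := by
      calc Λ * σ ^ 3 * m3 * B = Λ * (σ ^ 2 * σ) * m3 * B := by ring
        _ ≤ Λ * (2 * s * (2 * t)) * m3 * B := by rw [hσ2]; gcongr
        _ = _ := by ring
    have b4 : 0 ≤ Λ * M1 * (s * t) := by positivity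
    have a1' := abs_le.1 a1
    have a2'' := abs_le.1 a2'
    have a3' := abs_le.1 a3
    rw [abs_le]
    constructor <;> nlinarith
  · rw [wd_integrable hVc]
    simp only [e0]
    simpa [mul_assoc] using iM1.const_mul s
  · rw [wd_integral hVc]
    simp only [e0, mul_assoc]
    rw [integral_const_mul]
    have : 0 ≤ m1 * M2 + 2 * m1 * B + 4 * m3 * B := by positivity
    change s * M1 ≤ _
    nlinarith

end BLM

namespace BLM
open MeasureTheory ProbabilityTheory
open scoped ENNReal NNReal
set_option linter.unusedSectionVars false
set_option linter.unusedVariables false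

variable {E : Type*} [NormedAddCommGroup E] [InnerProductSpace ℝ E] [FiniteDimensional ℝ E]
  [MeasurableSpace E] [BorelSpace E]

open ContDiffBump in
lemma moll (ν : Measure E) [ν.IsAddHaarMeasure] {u : E → ℝ} {K : ℝ≥0} (hu : LipschitzWith K u) {δ : ℝ}
    (hδ : 0 < δ) : ∃ v : E → ℝ, ContDiff ℝ 2 v ∧ (∀ x, |v x - u x| ≤ K * δ) ∧ LipschitzWith K v ∧
      (ConvexOn ℝ Set.univ u → ConvexOn ℝ Set.univ v) ∧
      ∃ L, ∀ x y, ‖fderiv ℝ v x - fderiv ℝ v y‖ ≤ L * ‖x - y‖ := by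
  let φ : ContDiffBump (0:E) := ⟨δ / 2, δ, by positivity, by linarith⟩
  set f := φ.normed ν with hf
  have hfc : ContDiff ℝ 2 f := φ.contDiff_normed
  have hfs : HasCompactSupport f := φ.hasCompactSupport_normed
  have hf0 : ∀ x, 0 ≤ f x := φ.nonneg_normed
  have hf1 : ∫ x, f x ∂ν = 1 := φ.integral_normed
  have huc := hu.continuous
  have hfcont := hfc.continuous
  have hlu : ∀ x y, |u x - u y| ≤ K * ‖x - y‖ := fun x y => by
    simpa [dist_eq_norm] using hu.dist_le_mul x y
  have hint : ∀ x, Integrable (fun t => f t * u (x - t)) ν := fun x =>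
    Continuous.integrable_of_hasCompactSupport (by fun_prop) hfs.mul_right
  have hfi : Integrable f ν := hfcont.integrable_of_hasCompactSupport hfs
  set v := convolution f u (ContinuousLinearMap.lsmul ℝ ℝ) ν with hv
  have hvd : ∀ x, v x = ∫ t, f t * u (x - t) ∂ν := fun x => rfl
  refine ⟨v, ?_, fun x => ?_, ?_, fun hcv => ?_, ?_⟩
  · exact hfs.contDiff_convolution_left _ hfc huc.locallyIntegrable
  · rw [← Real.dist_eq]
    refine φ.dist_normed_convolution_le huc.aestronglyMeasurable fun y hy => ?_
    refine (hu.dist_le_mul y x).trans ?_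
    gcongr
    exact (Metric.mem_ball.1 hy).le
  · refine LipschitzWith.of_dist_le_mul fun x y => ?_
    rw [Real.dist_eq, hvd, hvd, ← integral_sub (hint x) (hint y), dist_eq_norm]
    refine abs_integral_le_integral_abs.trans ?_
    calc _ ≤ ∫ t, f t * (K * ‖x - y‖) ∂ν := by
          refine integral_mono_of_nonneg (.of_forall fun x => abs_nonneg _) (hfi.mul_const _)
            (.of_forall fun t => ?_)
          simp only
          rw [← mul_sub, abs_mul, abs_of_nonneg (hf0 t)]
          have := hlu (x - t) (y - t)
          rw [sub_sub_sub_cancel_right] at this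
          have h0 := hf0 t
          gcongr
      _ = _ := by rw [integral_mul_const, hf1, one_mul]
  · refine ⟨convex_univ, fun x _ y _ a b ha hb hab => ?_⟩
    rw [hvd, hvd, hvd, smul_eq_mul, smul_eq_mul, ← integral_const_mul, ← integral_const_mul,
      ← integral_add ((hint x).const_mul _) ((hint y).const_mul _)]
    refine integral_mono (hint _) (((hint x).const_mul _).add ((hint y).const_mul _)) fun t => ?_
    have := hcv.2 (Set.mem_univ (x - t)) (Set.mem_univ (y - t)) ha hb hab
    have e : a • x + b • y - t = a • (x - t) + b • (y - t) := by
      rw [smul_sub, smul_sub, sub_add_sub_comm, ← add_smul, hab, one_smul]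
    simp only
    rw [e]
    have := mul_le_mul_of_nonneg_left this (hf0 t)
    simp only [smul_eq_mul] at this
    linarith
  · have hD : ∀ x, HasFDerivAt v _ x := fun x => hfs.hasFDerivAt_convolution_left
      (ContinuousLinearMap.lsmul ℝ ℝ) (hfc.of_le (by norm_num)) huc.locallyIntegrable x
    have hDc : Continuous (fderiv ℝ f) := hfc.continuous_fderiv (by norm_num)
    have hDs : HasCompactSupport (fderiv ℝ f) := hfs.fderiv ℝ
    have hDi : Integrable (fderiv ℝ f) ν := hDc.integrable_of_hasCompactSupport hDs
    have hi2 : ∀ x, Integrable (fun t => u (x - t) • fderiv ℝ f t) ν := fun x =>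
      Continuous.integrable_of_hasCompactSupport (by fun_prop) (hDs.mono fun t ht => by
        intro h0
        exact ht (by simp only [h0, smul_zero]))
    have hD2 : ∀ x, fderiv ℝ v x = ∫ t, u (x - t) • fderiv ℝ f t ∂ν := by
      intro x
      rw [(hD x).fderiv, convolution_def]
      refine integral_congr_ae (.of_forall fun t => ?_)
      ext w
      simp [ContinuousLinearMap.precompL_apply, mul_comm]
    refine ⟨K * ∫ t, ‖fderiv ℝ f t‖ ∂ν, fun x y => ?_⟩
    rw [hD2, hD2, ← integral_sub (hi2 x) (hi2 y)]
    refine (norm_integral_le_integral_norm _).trans ?_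
    rw [mul_right_comm, ← integral_const_mul]
    refine integral_mono_of_nonneg (.of_forall fun x => norm_nonneg _) (hDi.norm.const_mul _)
            (.of_forall fun t => ?_)
    simp only
    rw [← sub_smul, norm_smul]
    have := hlu (x - t) (y - t)
    rw [sub_sub_sub_cancel_right] at this
    gcongr
    exact this

end BLM

namespace BLM
open MeasureTheory ProbabilityTheory
open scoped ENNReal NNReal
set_option linter.unusedSectionVars false
set_option linter.unusedVariables false

variable {E : Type*} [NormedAddCommGroup E] [InnerProductSpace ℝ E] [FiniteDimensional ℝ E]
  [MeasurableSpace E] [BorelSpace E]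

lemma st_deriv_zero {t : ℝ} (h : t < 0 ∨ 1 < t) : deriv Real.smoothTransition t = 0 := by
  rcases h with h | h
  · have : Real.smoothTransition =ᶠ[nhds t] fun _ => 0 := by
      filter_upwards [Iio_mem_nhds h] with y hy using Real.smoothTransition.zero_of_nonpos (le_of_lt hy)
    rw [this.deriv_eq]; simp
  · have : Real.smoothTransition =ᶠ[nhds t] fun _ => 1 := by
      filter_upwards [Ioi_mem_nhds h] with y hy using Real.smoothTransition.one_of_one_le (le_of_lt hy)
    rw [this.deriv_eq]; simp

lemma st_bound : ∃ K : ℝ, 0 < K ∧ ∀ t, |deriv Real.smoothTransition t| ≤ K := by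
  have hc : Continuous (deriv Real.smoothTransition) :=
    (Real.smoothTransition.contDiff (n := 1)).continuous_deriv (by norm_num)
  obtain ⟨K, hK⟩ := (isCompact_Icc (a := (0:ℝ)) (b := 1)).exists_bound_of_continuousOn hc.continuousOn
  refine ⟨max K 1, by positivity, fun t => ?_⟩
  by_cases h : t ∈ Set.Icc (0:ℝ) 1
  · exact (hK t h).trans (le_max_left _ _)
  · have : t < 0 ∨ 1 < t := by
      by_contra hh
      push Not at hh
      exact h ⟨hh.1, hh.2⟩
    rw [st_deriv_zero this, abs_zero]; positivity

lemma st_good {K : ℝ} (hK : ∀ t, |deriv Real.smoothTransition t| ≤ K) {D : E → ℝ} (hD : ContDiff ℝ 1 D)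
    (hD1 : ∀ x, ‖fderiv ℝ D x‖ ≤ 1) (a b : ℝ) :
    Good (K * |a|) (fun x => Real.smoothTransition (a * D x + b)) ∧
    ∀ x, fderiv ℝ (fun x => Real.smoothTransition (a * D x + b)) x
      = (deriv Real.smoothTransition (a * D x + b) * a) • fderiv ℝ D x := by
  have hs : ContDiff ℝ 1 Real.smoothTransition := Real.smoothTransition.contDiff (n := 1)
  have hd : ∀ x, fderiv ℝ (fun x => Real.smoothTransition (a * D x + b)) x
      = (deriv Real.smoothTransition (a * D x + b) * a) • fderiv ℝ D x := by
    intro x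
    have h1 : HasFDerivAt (fun x => a * D x + b) (a • fderiv ℝ D x) x :=
      ((hD.differentiable (by norm_num) x).hasFDerivAt.const_mul a).add_const b
    have h2 := (hs.differentiable (by norm_num) (a * D x + b)).hasDerivAt
    have h3 := (h2.comp_hasFDerivAt x h1).fderiv
    rw [smul_smul] at h3
    exact h3
  refine ⟨⟨?_, fun x => ?_, 1, fun x => ?_⟩, hd⟩
  · exact hs.comp ((contDiff_const.mul hD).add contDiff_const)
  · rw [hd, norm_smul, norm_mul, Real.norm_eq_abs, Real.norm_eq_abs]
    have h0 := (abs_nonneg _).trans (hK 0)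
    calc _ ≤ K * |a| * 1 := by
          gcongr
          · exact hK _
          · exact hD1 x
      _ = _ := mul_one _
  · rw [abs_of_nonneg (Real.smoothTransition.nonneg _)]; exact Real.smoothTransition.le_one _

lemma sandwich {μ : Measure E} [IsProbabilityMeasure μ] {h : E → ℝ} {T : Set E} (hT : MeasurableSet T)
    (hh : Integrable h μ) : ((∀ x ∈ T, h x ≤ 1) → (∀ x ∉ T, h x ≤ 0) → ∫ x, h x ∂μ ≤ μ.real T) ∧
    ((∀ x ∈ T, 1 ≤ h x) → (∀ x ∉ T, 0 ≤ h x) → μ.real T ≤ ∫ x, h x ∂μ) := by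
  have e : ∫ x, T.indicator (fun _ => (1:ℝ)) x ∂μ = μ.real T := by
    rw [integral_indicator_const _ hT]; simp
  have hi : Integrable (T.indicator (fun _ => (1:ℝ))) μ := (integrable_const _).indicator hT
  constructor
  · intro h1 h2
    rw [← e]
    refine integral_mono hh hi fun x => ?_
    by_cases hx : x ∈ T
    · simpa [hx] using h1 x hx
    · simpa [hx] using h2 x hx
  · intro h1 h2
    rw [← e]
    refine integral_mono hi hh fun x => ?_
    by_cases hx : x ∈ T
    · simpa [hx] using h1 x hx
    · simpa [hx] using h2 x hx

lemma iso_nice {K : ℝ} (hK0 : 0 < K) (hK : ∀ t, |deriv Real.smoothTransition t| ≤ K)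
    {V : E → ℝ} {W : E → E} {L lam : ℝ} (hV : NP V W L lam) (hlam : 0 < lam) (ν : Measure E)
    [ν.IsAddHaarMeasure] [IsProbabilityMeasure (wd ν V)] {R ε : ℝ} (hε : 0 < ε) (hR : ε < R)
    (hconc : Conc (wd ν V) (64 * R) (2 * R)) {S : Set E} (hS : MeasurableSet S) (hne : S.Nonempty) :
    (wd ν V).real S * (1 - (wd ν V).real S)
      ≤ (11 + 10240 * K) * (R / ε) * (wd ν V).real (Metric.thickening ε S \ S) := by
  have hR0 : 0 < R := hε.trans hR
  obtain ⟨C, s0, hs0, hch⟩ := hV.chain hlam ν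
  have him := hV.im ν
  set μ := wd ν V
  obtain ⟨D, hDc, hDd, hDl, -, -⟩ := moll ν (Metric.lipschitz_infDist_pt S) (δ := ε / 16) (by positivity)
  have hD1 : ∀ x, ‖fderiv ℝ D x‖ ≤ 1 := fun x => by
    simpa using norm_fderiv_le_of_lipschitz ℝ hDl (x₀ := x)
  have hDc1 : ContDiff ℝ 1 D := hDc.of_le (by norm_num)
  have hSin : ∀ x ∈ S, D x ≤ ε / 16 := fun x hx => by
    have := (abs_le.1 (hDd x)).2
    rw [Metric.infDist_zero_of_mem hx] at this
    simpa using this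
  have hSout : ∀ x, x ∉ Metric.thickening ε S → 15 / 16 * ε ≤ D x := fun x hx => by
    rw [Metric.mem_thickening_iff_infDist_lt hne, not_lt] at hx
    have := (abs_le.1 (hDd x)).1
    simp only [NNReal.coe_one, one_mul] at this
    linarith
  have hTm : MeasurableSet (Metric.thickening ε S \ S) := Metric.isOpen_thickening.measurableSet.diff hS
  set T := Metric.thickening ε S \ S with hT
  have hST : S ⊆ Metric.thickening ε S := Metric.self_subset_thickening hε S
  set st := Real.smoothTransition with hst
  obtain ⟨gf, df⟩ := st_good hK hDc1 hD1 (-4 / ε) (5 / 2)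
  obtain ⟨g1, d1⟩ := st_good hK hDc1 hD1 (8 / ε) (-1)
  obtain ⟨g2, d2⟩ := st_good hK hDc1 hD1 (-8 / ε) 7
  set f := fun x => st (-4 / ε * D x + 5 / 2) with hf
  set f1 := fun x => st (8 / ε * D x + -1) with hf1
  set f2 := fun x => st (-8 / ε * D x + 7) with hf2
  have st0 := Real.smoothTransition.nonneg
  have st1 := Real.smoothTransition.le_one
  have abs1 : ∀ t, |st t| ≤ 1 := fun t => by rw [abs_of_nonneg (st0 t)]; exact st1 t
  have g12 := g1.mul g2 (fun x => abs1 _) (fun x => abs1 _)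
  have gc := (Good.const (E := E) (4 * K / ε)).mul g12 (a := 4 * K / ε) (b := 1)
    (fun x => by rw [abs_of_nonneg (by positivity)])
    (fun x => by rw [abs_mul]; exact mul_le_one₀ (abs1 _) (abs_nonneg _) (abs1 _))
  set G := fun x => 4 * K / ε * (f1 x * f2 x) with hG
  have hG0 : ∀ x, 0 ≤ G x := fun x =>
    mul_nonneg (by positivity) (mul_nonneg (st0 _) (st0 _))
  have tt : ∀ x, ∃ t, D x = t * ε := fun x => ⟨D x / ε, by field_simp⟩
  have hfG : ∀ x, ‖fderiv ℝ f x‖ ≤ G x := by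
    intro x
    obtain ⟨t, ht⟩ := tt x
    have e0 : -4 / ε * D x + 5 / 2 = -4 * t + 5 / 2 := by rw [ht]; field_simp
    have e1 : 8 / ε * D x + -1 = 8 * t - 1 := by rw [ht]; field_simp; ring
    have e2 : -8 / ε * D x + 7 = -8 * t + 7 := by rw [ht]; field_simp
    by_cases hh : 1 / 4 ≤ t ∧ t ≤ 3 / 4
    · have q1 : f1 x = 1 := by
        simp only [hf1, e1]; exact Real.smoothTransition.one_of_one_le (by linarith)
      have q2 : f2 x = 1 := by
        simp only [hf2, e2]; exact Real.smoothTransition.one_of_one_le (by linarith)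
      simp only [hG, q1, q2, mul_one]
      refine (gf.lip x).trans (le_of_eq ?_)
      rw [abs_div, abs_neg, abs_of_pos (show (0:ℝ) < 4 by norm_num), abs_of_pos hε]; ring
    · have : -4 / ε * D x + 5 / 2 < 0 ∨ 1 < -4 / ε * D x + 5 / 2 := by
        rw [e0]
        by_contra hcon
        push Not at hcon
        exact hh ⟨by linarith, by linarith⟩
      rw [df, st_deriv_zero this]
      simpa using hG0 x
  have fS : ∀ x ∈ S, f x = 1 ∧ f1 x = 0 := by
    intro x hx
    obtain ⟨t, ht⟩ := tt x
    have e0 : -4 / ε * D x + 5 / 2 = -4 * t + 5 / 2 := by rw [ht]; field_simp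
    have e1 : 8 / ε * D x + -1 = 8 * t - 1 := by rw [ht]; field_simp; ring
    have h1 := hSin x hx
    have h2 : t ≤ 1 / 16 := by rw [ht] at h1; nlinarith
    constructor
    · simp only [hf, e0]; exact Real.smoothTransition.one_of_one_le (by linarith)
    · simp only [hf1, e1]; exact Real.smoothTransition.zero_of_nonpos (by linarith)
  have fO : ∀ x, x ∉ Metric.thickening ε S → f x = 0 ∧ f2 x = 0 := by
    intro x hx
    obtain ⟨t, ht⟩ := tt x
    have e0 : -4 / ε * D x + 5 / 2 = -4 * t + 5 / 2 := by rw [ht]; field_simp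
    have e2 : -8 / ε * D x + 7 = -8 * t + 7 := by rw [ht]; field_simp
    have h1 := hSout x hx
    have h2 : 15 / 16 ≤ t := by rw [ht] at h1; nlinarith
    constructor
    · simp only [hf, e0]; exact Real.smoothTransition.zero_of_nonpos (by linarith)
    · simp only [hf2, e2]; exact Real.smoothTransition.zero_of_nonpos (by linarith)
  have outT : ∀ x, x ∉ T → x ∈ S ∨ x ∉ Metric.thickening ε S := by
    intro x hx
    by_contra hcon
    push Not at hcon
    exact hx ⟨hcon.2, hcon.1⟩
  set τ := μ.real T
  set a := μ.real S
  have hτ : 0 ≤ τ := measureReal_nonneg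
  have if1 := gf.int μ
  have I1 : ∫ x, f1 x * f2 x ∂μ ≤ τ := (sandwich hTm (g12.int μ)).1
    (fun x _ => mul_le_one₀ (st1 _) (st0 _) (st1 _)) (fun x hx => by
      rcases outT x hx with h | h
      · rw [(fS x h).2]; simp
      · rw [(fO x h).2]; simp)
  have gff : Integrable (fun x => f x * (1 - f x)) μ := by
    refine Integrable.of_bound (by have := gf.cont; fun_prop) 1 (.of_forall fun x => ?_)
    have h0 : 0 ≤ f x := st0 _
    have h1 : f x ≤ 1 := st1 _
    rw [Real.norm_of_nonneg (by nlinarith)]; nlinarith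
  have I2 : ∫ x, f x * (1 - f x) ∂μ ≤ τ := (sandwich hTm gff).1
    (fun x _ => by
      have h0 : 0 ≤ f x := st0 _
      have h1 : f x ≤ 1 := st1 _
      nlinarith) (fun x hx => by
      rcases outT x hx with h | h
      · rw [(fS x h).1]; simp
      · rw [(fO x h).1]; simp)
  have I3 : a ≤ ∫ x, f x ∂μ := (sandwich hS if1).2 (fun x hx => (fS x hx).1.ge) (fun x _ => st0 _)
  have I4 : ∫ x, f x ∂μ ≤ a + τ := by
    have := (sandwich (Metric.isOpen_thickening (δ := ε) (E := S)).measurableSet if1).1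
      (fun x hx => st1 _) (fun x hx => (fO x hx).1.le)
    refine this.trans ?_
    rw [show a + τ = μ.real (S ∪ T) from (measureReal_union Set.disjoint_sdiff_right hTm).symm]
    refine measureReal_mono ?_
    rw [hT]; intro x hx
    by_cases h : x ∈ S
    · exact Or.inl h
    · exact Or.inr ⟨hx, h⟩
  have I5 : ∫ x, G x ∂μ ≤ 4 * K / ε * τ := by
    simp only [hG]
    rw [integral_const_mul]
    gcongr
  set Mf := ∫ x, f x ∂μ with hMf
  have hMf1 : Mf ≤ 1 := by
    have := integral_mono if1 (integrable_const (1:ℝ)) (fun x => st1 _)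
    simpa using this
  have hMf0 : 0 ≤ Mf := integral_nonneg fun x => st0 _
  have hQ : Mf * (1 - Mf) ≤ 10 * τ + 2560 * R * (4 * K / ε * τ) := by
    obtain ⟨Λ, hfΛ, hGΛ⟩ : ∃ Λ, Good Λ f ∧ Good Λ G :=
      ⟨_, gf.mono (le_max_left _ _), gc.mono (le_max_right _ _)⟩
    have hc := hfΛ.cont
    have hRG : 2560 * R * ∫ x, G x ∂μ ≤ 2560 * R * (4 * K / ε * τ) := by gcongr
    by_cases hM : Mf ≤ 3 / 4
    · have := nice_thm hlam hs0 hR0 hch him hconc hfΛ hGΛ (fun x => st0 _) (fun x => st1 _) hfG hM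
      nlinarith
    · have fd : ∀ x, fderiv ℝ (fun x => 1 - f x) x = -fderiv ℝ f x := fun x => by
        rw [fderiv_const_sub]
      have g' : Good Λ (fun x => 1 - f x) := by
        refine ⟨contDiff_const.sub hfΛ.cd, fun x => ?_, 1, fun x => ?_⟩
        · rw [fd, norm_neg]; exact hfΛ.lip x
        · have h0 : 0 ≤ f x := st0 _
          have h1 : f x ≤ 1 := st1 _
          rw [abs_of_nonneg (by linarith)]; linarith
      have e : ∫ x, (1 - f x) ∂μ = 1 - Mf := by
        rw [integral_sub (integrable_const _) if1]; simp [hMf]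
      have := nice_thm hlam hs0 hR0 hch him hconc g' hGΛ (fun x => sub_nonneg.2 (st1 _))
        (fun x => by have h0 : 0 ≤ f x := st0 _
                     linarith) (fun x => by rw [fd, norm_neg]; exact hfG x)
        (by rw [e]; linarith)
      have e2 : ∫ x, (1 - f x) * (1 - (1 - f x)) ∂μ = ∫ x, f x * (1 - f x) ∂μ :=
        integral_congr_ae (.of_forall fun x => by simp only; ring)
      rw [e, e2] at this
      nlinarith
  have ha0 : 0 ≤ a := measureReal_nonneg
  have hre : 1 ≤ R / ε := by rw [one_le_div hε]; exact hR.le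
  have h1 : a * (1 - a) ≤ Mf * (1 - Mf) + τ := by nlinarith
  have h2 : 2560 * R * (4 * K / ε * τ) = 10240 * K * (R / ε) * τ := by ring
  nlinarith [mul_nonneg (sub_nonneg.2 hre) hτ]

end BLM

namespace BLM
open MeasureTheory ProbabilityTheory
open scoped ENNReal NNReal
set_option linter.unusedSectionVars false
set_option linter.unusedVariables false

variable {E : Type*} [NormedAddCommGroup E] [InnerProductSpace ℝ E] [FiniteDimensional ℝ E]
  [MeasurableSpace E] [BorelSpace E]

lemma conv_grad {v : E → ℝ} (hc : ConvexOn ℝ Set.univ v) (hd : Differentiable ℝ v) (x w : E) :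
    fderiv ℝ v x w ≤ v (x + w) - v x := by
  have h2 : HasDerivAt (fun t : ℝ => x + t • w) w 0 := by
    simpa using ((hasDerivAt_id (0:ℝ)).smul_const w).const_add x
  have h3 : HasDerivAt (fun t : ℝ => v (x + t • w)) (fderiv ℝ v x w) 0 := by
    have h4 : HasFDerivAt v (fderiv ℝ v x) (x + (0:ℝ) • w) := by
      simpa using (hd x).hasFDerivAt
    exact h4.comp_hasDerivAt 0 h2
  have h5 := h3.tendsto_slope_zero_right
  refine le_of_tendsto h5 ?_
  filter_upwards [Ioo_mem_nhdsGT (show (0:ℝ) < 1 by norm_num)] with t ht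
  simp only [zero_add, zero_smul, add_zero, smul_eq_mul]
  have := hc.2 (Set.mem_univ x) (Set.mem_univ (x + w)) (show 0 ≤ 1 - t by linarith [ht.2]) ht.1.le (by ring)
  rw [show (1 - t) • x + t • (x + w) = x + t • w by rw [sub_smul, smul_add, one_smul]; abel] at this
  simp only [smul_eq_mul] at this
  rw [inv_mul_le_iff₀ ht.1]
  linarith

lemma conv_mono {v : E → ℝ} (hc : ConvexOn ℝ Set.univ v) (hd : Differentiable ℝ v) (x y : E) :
    0 ≤ (fderiv ℝ v x - fderiv ℝ v y) (x - y) := by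
  have h1 := conv_grad hc hd x (y - x)
  have h2 := conv_grad hc hd y (x - y)
  rw [add_sub_cancel] at h1 h2
  rw [sub_apply, ← neg_sub y x, map_neg]
  rw [← neg_sub y x, map_neg] at h2
  rw [map_neg]
  linarith

lemma coercive (ν : Measure E) [ν.IsAddHaarMeasure] {ρ : E → ℝ} (hρ : Continuous ρ)
    (hc : ConvexOn ℝ Set.univ ρ) (hi : Integrable (fun x => Real.exp (-ρ x)) ν) :
    ∃ a b : ℝ, 0 < a ∧ ∀ x, a * ‖x‖ - b ≤ ρ x := by
  set M := ρ 0 + 1 with hM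
  set K := {x | ρ x ≤ M} with hK
  have hKm : MeasurableSet K := (isClosed_le hρ continuous_const).measurableSet
  have hKfin : ν K < ∞ := by
    have h1 : K ⊆ {x | Real.exp (-M) ≤ ‖Real.exp (-ρ x)‖} := by
      intro x hx
      simp only [Set.mem_setOf_eq]
      rw [Real.norm_of_nonneg (Real.exp_pos _).le, Real.exp_le_exp]
      exact neg_le_neg hx
    exact (measure_mono h1).trans_lt (hi.measure_norm_ge_lt_top (Real.exp_pos _))
  obtain ⟨r, hr, hrK⟩ : ∃ r > 0, Metric.ball (0:E) r ⊆ K := by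
    have : K ∈ nhds (0:E) := by
      have : ∀ᶠ x in nhds (0:E), ρ x < M := hρ.continuousAt.eventually_lt_const (by linarith)
      filter_upwards [this] with x hx using hx.le
    exact Metric.mem_nhds_iff.1 this
  have hBpos : 0 < ν (Metric.ball (0:E) (r / 2)) := Metric.measure_ball_pos ν 0 (by positivity)
  have hBfin : ν (Metric.ball (0:E) (r / 2)) < ∞ := measure_ball_lt_top
  obtain ⟨n, hn⟩ : ∃ n : ℕ, ν K < n * ν (Metric.ball (0:E) (r / 2)) := by
    obtain ⟨n, hn⟩ := ENNReal.exists_nat_mul_gt hBpos.ne' hKfin.ne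
    exact ⟨n, hn⟩
  have hbound : ∀ x ∈ K, ‖x‖ < 2 * n * r + 1 := by
    intro x hx
    by_contra hcon
    push Not at hcon
    have hxp : 0 < ‖x‖ := by
      have : 0 ≤ 2 * (n:ℝ) * r := by positivity
      linarith
    let c : ℕ → E := fun j => (j * r / ‖x‖) • x
    have hsub : ∀ j ∈ Finset.range n, Metric.ball (c j) (r / 2) ⊆ K := by
      intro j hj z hz
      have hj' : (j:ℝ) ≤ n := by exact_mod_cast (Finset.mem_range.1 hj).le
      set t := j * r / ‖x‖ with ht
      have ht0 : 0 ≤ t := by positivity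
      have ht1 : t ≤ 1 / 2 := by
        rw [ht, div_le_iff₀ hxp]
        have : (j:ℝ) * r ≤ n * r := by gcongr
        linarith
      have h1t : 0 < 1 - t := by linarith
      have hw : (1 - t)⁻¹ • (z - t • x) ∈ K := by
        apply hrK
        rw [mem_ball_zero_iff, norm_smul, norm_inv, Real.norm_of_nonneg h1t.le, inv_mul_lt_iff₀ h1t]
        have : ‖z - t • x‖ < r / 2 := by simpa [dist_eq_norm] using hz
        nlinarith
      have := hc.2 (Set.mem_univ x) (Set.mem_univ ((1 - t)⁻¹ • (z - t • x))) ht0 h1t.le (by ring)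
      rw [smul_smul, mul_inv_cancel₀ h1t.ne', one_smul, add_sub_cancel] at this
      have hx' : ρ x ≤ M := hx
      have hw' : ρ ((1 - t)⁻¹ • (z - t • x)) ≤ M := hw
      simp only [smul_eq_mul] at this
      change ρ z ≤ M
      nlinarith
    have hdis : Set.PairwiseDisjoint (↑(Finset.range n)) (fun j => Metric.ball (c j) (r / 2)) := by
      intro i _ j _ hij
      refine Metric.ball_disjoint_ball ?_
      have e : c i - c j = ((((i:ℤ) - (j:ℤ) : ℤ) : ℝ) * r / ‖x‖) • x := by
        simp only [c]
        rw [← sub_smul]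
        congr 1
        push_cast
        ring
      rw [dist_eq_norm, e, norm_smul, norm_div, norm_mul, norm_norm, div_mul_cancel₀ _ hxp.ne',
        Real.norm_of_nonneg hr.le, Real.norm_eq_abs, ← Int.cast_abs]
      have : (1:ℤ) ≤ |(i:ℤ) - j| := Int.one_le_abs (sub_ne_zero.2 (by exact_mod_cast hij))
      have : (1:ℝ) ≤ ((|(i:ℤ) - j| : ℤ) : ℝ) := by exact_mod_cast this
      nlinarith
    have h1 : ν (⋃ j ∈ Finset.range n, Metric.ball (c j) (r / 2)) ≤ ν K :=
      measure_mono (Set.iUnion₂_subset hsub)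
    rw [measure_biUnion_finset hdis (fun j _ => Metric.isOpen_ball.measurableSet)] at h1
    have e : ∀ j, ν (Metric.ball (c j) (r / 2)) = ν (Metric.ball (0:E) (r / 2)) := fun j =>
      Measure.addHaar_ball_center ν (c j) (r / 2)
    simp only [e, Finset.sum_const, Finset.card_range, nsmul_eq_mul] at h1
    exact absurd hn (not_lt.2 h1)
  set T := 2 * n * r + 1 with hT
  have hTp : 0 < T := by positivity
  obtain ⟨m, hm⟩ := (isCompact_closedBall (0:E) T).exists_bound_of_continuousOn hρ.continuousOn
  refine ⟨1 / T, m + 1 + |ρ 0|, by positivity, fun x => ?_⟩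
  by_cases hx : ‖x‖ ≤ T
  · have h1 := hm x (by simpa using hx)
    have h2 := (abs_le.1 h1).1
    have h3 : 1 / T * ‖x‖ ≤ 1 := by
      rw [one_div, inv_mul_le_iff₀ hTp]; linarith
    linarith [abs_nonneg (ρ 0)]
  · push Not at hx
    have hxp : 0 < ‖x‖ := hTp.trans hx
    set t := T / ‖x‖ with ht
    have ht0 : 0 < t := by positivity
    have ht1 : t ≤ 1 := by rw [ht, div_le_one hxp]; exact hx.le
    have hnK : ¬ (ρ (t • x) ≤ M) := by
      intro hh
      have := hbound _ hh
      rw [norm_smul, Real.norm_of_nonneg ht0.le, ht, div_mul_cancel₀ _ hxp.ne'] at this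
      exact lt_irrefl _ this
    have := hc.2 (Set.mem_univ x) (Set.mem_univ (0:E)) ht0.le (sub_nonneg.2 ht1) (by ring)
    rw [smul_zero, add_zero] at this
    simp only [smul_eq_mul] at this
    push Not at hnK
    have h4 : 1 ≤ t * (ρ x - ρ 0) := by linarith
    have h5 : 1 / T * ‖x‖ ≤ ρ x - ρ 0 := by
      rw [ht, div_mul_eq_mul_div, le_div_iff₀ hxp] at h4
      rw [one_div, inv_mul_le_iff₀ hTp]
      linarith
    have h6 : 0 ≤ m := (norm_nonneg _).trans (hm 0 (by simpa using hTp.le))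
    linarith [neg_abs_le (ρ 0)]

/-- largest convex `m`-Lipschitz minorant exists -/
lemma lipminorant {ρ : E → ℝ} (hd : Differentiable ℝ ρ) (hc : ConvexOn ℝ Set.univ ρ) {a b : ℝ} (ha : 0 < a)
    (hab : ∀ x, a * ‖x‖ - b ≤ ρ x) (m : ℝ≥0) (ham : a ≤ m) :
    ∃ h : E → ℝ, ConvexOn ℝ Set.univ h ∧ LipschitzWith m h ∧ (∀ x, a * ‖x‖ - b ≤ h x) ∧
      ∀ x, ‖fderiv ℝ ρ x‖ ≤ m → h x = ρ x := by
  let A := {k : E → ℝ // ConvexOn ℝ Set.univ k ∧ LipschitzWith m k ∧ ∀ x, k x ≤ ρ x}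
  have mem1 : ConvexOn ℝ Set.univ (fun x : E => a * ‖x‖ - b) ∧ LipschitzWith m (fun x : E => a * ‖x‖ - b)
      ∧ ∀ x, a * ‖x‖ - b ≤ ρ x := by
    refine ⟨?_, ?_, hab⟩
    · refine ⟨convex_univ, fun x _ y _ s t hs ht hst => ?_⟩
      have h1 := norm_add_le (s • x) (t • y)
      rw [norm_smul, norm_smul, Real.norm_of_nonneg hs, Real.norm_of_nonneg ht] at h1
      simp only [smul_eq_mul]
      have h2 : b = s * b + t * b := by rw [← add_mul, hst, one_mul]
      nlinarith
    · refine LipschitzWith.of_dist_le_mul fun x y => ?_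
      rw [Real.dist_eq, show a * ‖x‖ - b - (a * ‖y‖ - b) = a * (‖x‖ - ‖y‖) by ring, abs_mul,
        abs_of_pos ha, dist_eq_norm]
      gcongr
      exact abs_norm_sub_norm_le x y
  let k0 : A := ⟨_, mem1⟩
  haveI : Nonempty A := ⟨k0⟩
  let h : E → ℝ := fun x => ⨆ k : A, k.1 x
  have hbd : ∀ x, BddAbove (Set.range fun k : A => k.1 x) := fun x => ⟨ρ x, by
    rintro _ ⟨k, rfl⟩
    exact k.2.2.2 x⟩
  have le_h : ∀ (k : A) x, k.1 x ≤ h x := fun k x => le_ciSup (hbd x) k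
  refine ⟨h, ⟨convex_univ, fun x _ y _ s t hs ht hst => ?_⟩, ?_, fun x => le_h k0 x, fun x hx => ?_⟩
  · refine ciSup_le fun k => (k.2.1.2 (Set.mem_univ x) (Set.mem_univ y) hs ht hst).trans ?_
    simp only [smul_eq_mul]
    have h1 := le_h k x
    have h2 := le_h k y
    gcongr
  · refine LipschitzWith.of_le_add_mul m fun x y => ?_
    refine ciSup_le fun k => ?_
    have h1 := (abs_le.1 (k.2.2.1.dist_le_mul x y)).2
    have h2 := le_h k y
    linarith
  · refine le_antisymm (ciSup_le fun k => k.2.2.2 x) ?_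
    have mem2 : ConvexOn ℝ Set.univ (fun y : E => ρ x + fderiv ℝ ρ x (y - x)) ∧
        LipschitzWith m (fun y : E => ρ x + fderiv ℝ ρ x (y - x))
        ∧ ∀ y, ρ x + fderiv ℝ ρ x (y - x) ≤ ρ y := by
      refine ⟨⟨convex_univ, fun y _ z _ s t hs ht hst => le_of_eq ?_⟩, ?_, fun y => ?_⟩
      · simp only [map_sub, map_add, map_smul, smul_eq_mul]
        have : t = 1 - s := by linarith
        subst this
        ring
      · refine LipschitzWith.of_dist_le_mul fun y z => ?_
        rw [Real.dist_eq, show ρ x + fderiv ℝ ρ x (y - x) - (ρ x + fderiv ℝ ρ x (z - x))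
          = fderiv ℝ ρ x (y - z) by simp only [map_sub]; ring, dist_eq_norm]
        refine ((fderiv ℝ ρ x).le_opNorm _).trans ?_
        gcongr
      · have := conv_grad hc hd x (y - x)
        rw [add_sub_cancel] at this
        linarith
    have := le_h ⟨_, mem2⟩ x
    simpa using this

end BLM

namespace BLM
open MeasureTheory ProbabilityTheory
open scoped ENNReal NNReal
set_option linter.unusedSectionVars false
set_option linter.unusedVariables false

variable {E : Type*} [NormedAddCommGroup E] [InnerProductSpace ℝ E] [FiniteDimensional ℝ E]
  [MeasurableSpace E] [BorelSpace E]

lemma mkNP {v : E → ℝ} (h2 : ContDiff ℝ 2 v) (hc : ConvexOn ℝ Set.univ v) {L : ℝ}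
    (hL : ∀ x y, ‖fderiv ℝ v x - fderiv ℝ v y‖ ≤ L * ‖x - y‖) {a b : ℝ} (ha : 0 < a)
    (hab : ∀ x, a * ‖x‖ - b ≤ v x) {s : ℝ} (hs : 0 < s) (c : ℝ) :
    ∃ W : E → E, ∃ L', NP (fun x => v x + s / 2 * ‖x‖ ^ 2 + c) W L' s := by
  have hd : Differentiable ℝ v := h2.differentiable (by norm_num)
  set T := (InnerProductSpace.toDual ℝ E).symm with hT
  refine ⟨fun x => T (fderiv ℝ v x) + s • x, |L| + s, ?_, ?_, ?_, ?_, ?_⟩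
  · intro x
    have h3 : HasFDerivAt (fun x : E => ‖x‖ ^ 2) ((2:ℝ) • (innerSL ℝ x)) x := by
      refine (hasStrictFDerivAt_norm_sq x).hasFDerivAt.congr_fderiv ?_
      ext w
      simp
    have h4 := ((hd x).hasFDerivAt.add (h3.const_mul (s / 2))).add_const c
    refine h4.congr_fderiv ?_
    ext w
    simp [hT, inner_add_left, inner_smul_left, InnerProductSpace.toDual_symm_apply]
    ring
  · have h5 : ContDiff ℝ 1 (fderiv ℝ v) := h2.fderiv_right (by norm_num)
    have h6 : ContDiff ℝ 1 (fun x => T (fderiv ℝ v x)) :=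
      (InnerProductSpace.toDual ℝ E).symm.toContinuousLinearEquiv.contDiff.comp h5
    exact h6.add (contDiff_id.const_smul s)
  · intro x
    refine norm_fderiv_le_of_lip' ℝ (by positivity) (.of_forall fun y => ?_)
    have e : T (fderiv ℝ v y) + s • y - (T (fderiv ℝ v x) + s • x)
        = T (fderiv ℝ v y - fderiv ℝ v x) + s • (y - x) := by
      rw [map_sub, smul_sub]; abel
    rw [e]
    refine (norm_add_le _ _).trans ?_
    rw [LinearIsometryEquiv.norm_map, norm_smul, Real.norm_of_nonneg hs.le, add_mul]
    have := hL y x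
    have := mul_le_mul_of_nonneg_right (le_abs_self L) (norm_nonneg (y - x))
    linarith
  · intro x y
    have e : T (fderiv ℝ v x) + s • x - (T (fderiv ℝ v y) + s • y)
        = T (fderiv ℝ v x - fderiv ℝ v y) + s • (x - y) := by
      rw [map_sub, smul_sub]; abel
    rw [e, inner_add_left, inner_smul_left, real_inner_self_eq_norm_sq, hT,
      InnerProductSpace.toDual_symm_apply]
    have := conv_mono hc hd x y
    simpa using this
  · refine ⟨Real.exp (b - c), a, ha, fun x => ?_⟩
    rw [← Real.exp_add, Real.exp_le_exp]
    have := hab x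
    have : 0 ≤ s / 2 * ‖x‖ ^ 2 := by positivity
    linarith

lemma approx (ν : Measure E) [ν.IsAddHaarMeasure] {ρ : E → ℝ} (hd : Differentiable ℝ ρ)
    (hc : ConvexOn ℝ Set.univ ρ) (hi : Integrable (fun x => Real.exp (-ρ x)) ν)
    (h1 : ∫ x, Real.exp (-ρ x) ∂ν = 1) {η : ℝ} (hη : 0 < η) :
    ∃ (V : E → ℝ) (W : E → E) (L lam : ℝ), 0 < lam ∧ NP V W L lam ∧ ∫ x, Real.exp (-V x) ∂ν = 1 ∧
      ∫ x, |Real.exp (-V x) - Real.exp (-ρ x)| ∂ν ≤ η := by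
  obtain ⟨a, b, ha, hab⟩ := coercive ν hd.continuous hc hi
  have key : ∀ m : ℕ, ∃ v : E → ℝ, ContDiff ℝ 2 v ∧ ConvexOn ℝ Set.univ v ∧
      (∃ L, ∀ x y, ‖fderiv ℝ v x - fderiv ℝ v y‖ ≤ L * ‖x - y‖) ∧
      (∀ x, a * ‖x‖ - (b + 1) ≤ v x) ∧
      ∀ x, ‖fderiv ℝ ρ x‖ ≤ m → |v x - ρ x| ≤ 1 / ((m:ℝ) + 1) := by
    intro m
    set K : ℝ≥0 := (m : ℝ≥0) + (⌈a⌉₊ : ℝ≥0) with hK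
    have haK : a ≤ K := by
      have := Nat.le_ceil a
      have h0 : (0:ℝ) ≤ m := by positivity
      rw [hK]; push_cast; linarith
    have hmK : (m:ℝ) ≤ K := by
      have h0 : (0:ℝ) ≤ ⌈a⌉₊ := by positivity
      rw [hK]; push_cast; linarith
    obtain ⟨h, hhc, hhl, hhb, hhe⟩ := lipminorant hd hc ha hab K haK
    have hδ : (0:ℝ) < 1 / (((m:ℝ) + 1) * (K + 1)) := by positivity
    obtain ⟨v, hv2, hvh, hvl, hvc, hvL⟩ := moll ν hhl hδ
    have hb1 : (K:ℝ) * (1 / (((m:ℝ) + 1) * (K + 1))) ≤ 1 / ((m:ℝ) + 1) := by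
      rw [mul_one_div, div_le_div_iff₀ (by positivity) (by positivity)]
      have : (0:ℝ) ≤ m := by positivity
      nlinarith [K.coe_nonneg]
    have hb2 : 1 / ((m:ℝ) + 1) ≤ 1 := by
      rw [div_le_one (by positivity)]
      have : (0:ℝ) ≤ m := by positivity
      linarith
    refine ⟨v, hv2, hvc hhc, hvL, fun x => ?_, fun x hx => ?_⟩
    · have := abs_le.1 (hvh x)
      have := hhb x
      linarith [this]
    · rw [← hhe x (hx.trans hmK)]
      exact (hvh x).trans hb1
  choose v hv2 hvc hvL hvb hve using key
  set U : ℕ → E → ℝ := fun m x => v m x + (1 / ((m:ℝ) + 1)) / 2 * ‖x‖ ^ 2 with hU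
  have hUc : ∀ m, Continuous (U m) := fun m => by
    have := (hv2 m).continuous
    simp only [hU]; fun_prop
  have hρc := hd.continuous
  set D : E → ℝ := fun x => Real.exp (b + 1) * Real.exp (-(a * ‖x‖)) with hD
  have hDi : Integrable D ν := by
    have := (int_poly ν 0 ha).const_mul (Real.exp (b + 1))
    simpa using this
  have hUD : ∀ m x, Real.exp (-U m x) ≤ D x := by
    intro m x
    rw [hD]; dsimp only
    rw [← Real.exp_add, Real.exp_le_exp]
    have := hvb m x
    have : 0 ≤ (1 / ((m:ℝ) + 1)) / 2 * ‖x‖ ^ 2 := by positivity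
    simp only [hU]; linarith
  have hUi : ∀ m, Integrable (fun x => Real.exp (-U m x)) ν := fun m => by
    have := hUc m
    refine hDi.mono' (by fun_prop) (.of_forall fun x => ?_)
    rw [Real.norm_of_nonneg (by positivity)]; exact hUD m x
  have hs : Filter.Tendsto (fun m : ℕ => 1 / ((m:ℝ) + 1)) Filter.atTop (nhds 0) :=
    tendsto_one_div_add_atTop_nhds_zero_nat
  have hpt : ∀ x, Filter.Tendsto (fun m => U m x) Filter.atTop (nhds (ρ x)) := by
    intro x
    have t1 : Filter.Tendsto (fun m => v m x) Filter.atTop (nhds (ρ x)) := by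
      rw [tendsto_iff_dist_tendsto_zero]
      refine squeeze_zero' (.of_forall fun _ => dist_nonneg) ?_ hs
      filter_upwards [Filter.eventually_ge_atTop ⌈‖fderiv ℝ ρ x‖⌉₊] with m hm
      rw [Real.dist_eq]
      exact hve m x ((Nat.le_ceil _).trans (by exact_mod_cast hm))
    have t2 := t1.add ((hs.div_const 2).mul_const (‖x‖ ^ 2))
    simpa [hU] using t2
  have hexp : ∀ x, Filter.Tendsto (fun m => Real.exp (-U m x)) Filter.atTop
      (nhds (Real.exp (-ρ x))) := fun x => (Real.continuous_exp.tendsto _).comp (hpt x).neg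
  have hI : Filter.Tendsto (fun m => ∫ x, |Real.exp (-U m x) - Real.exp (-ρ x)| ∂ν) Filter.atTop
      (nhds 0) := by
    have := tendsto_integral_of_dominated_convergence (μ := ν)
      (F := fun m x => |Real.exp (-U m x) - Real.exp (-ρ x)|) (f := fun _ => (0:ℝ))
      (fun x => D x + Real.exp (-ρ x)) (fun m => by have := hUc m; fun_prop)
      (hDi.add hi) (fun m => .of_forall fun x => ?_) (.of_forall fun x => ?_)
    · simpa using this
    · rw [Real.norm_eq_abs, abs_abs, abs_le]
      have := hUD m x
      have := Real.exp_pos (-U m x)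
      have := Real.exp_pos (-ρ x)
      constructor <;> linarith
    · have := ((hexp x).sub_const (Real.exp (-ρ x))).abs
      simpa using this
  obtain ⟨m, hm⟩ := ((Metric.tendsto_atTop.1 hI) (min (η / 2) (1 / 2)) (by positivity))
  have hm := hm m le_rfl
  rw [Real.dist_eq, sub_zero, abs_of_nonneg (integral_nonneg fun _ => abs_nonneg _), lt_min_iff] at hm
  set J := ∫ x, |Real.exp (-U m x) - Real.exp (-ρ x)| ∂ν with hJ
  set Z := ∫ x, Real.exp (-U m x) ∂ν with hZ
  have hZ1 : |Z - 1| ≤ J := by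
    rw [hZ, ← h1, ← integral_sub (hUi m) hi]
    exact abs_integral_le_integral_abs
  have hZp : 0 < Z := by
    have := (abs_le.1 hZ1).1
    linarith [hm.2]
  obtain ⟨L, hL⟩ := hvL m
  obtain ⟨W, L', hNP⟩ := mkNP (hv2 m) (hvc m) hL ha (hvb m)
    (show 0 < 1 / ((m:ℝ) + 1) by positivity) (Real.log Z)
  have eV : ∀ x, Real.exp (-(U m x + Real.log Z)) = Real.exp (-U m x) * Z⁻¹ := by
    intro x
    rw [neg_add, Real.exp_add, Real.exp_neg (Real.log Z), Real.exp_log hZp]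
  refine ⟨fun x => U m x + Real.log Z, W, L', _, show 0 < 1 / ((m:ℝ) + 1) by positivity, hNP, ?_, ?_⟩
  · simp_rw [eV]
    rw [integral_mul_const, ← hZ, mul_inv_cancel₀ hZp.ne']
  · simp_rw [eV]
    have h6 : ∀ x, |Real.exp (-U m x) * Z⁻¹ - Real.exp (-ρ x)| ≤
        |Z⁻¹ - 1| * Real.exp (-U m x) + |Real.exp (-U m x) - Real.exp (-ρ x)| := by
      intro x
      rw [show Real.exp (-U m x) * Z⁻¹ - Real.exp (-ρ x) = (Z⁻¹ - 1) * Real.exp (-U m x) +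
        (Real.exp (-U m x) - Real.exp (-ρ x)) by ring]
      refine (abs_add_le _ _).trans ?_
      rw [abs_mul, abs_of_pos (Real.exp_pos _)]
    have i2 : Integrable (fun x => |Real.exp (-U m x) - Real.exp (-ρ x)|) ν := ((hUi m).sub hi).abs
    calc _ ≤ ∫ x, (|Z⁻¹ - 1| * Real.exp (-U m x) + |Real.exp (-U m x) - Real.exp (-ρ x)|) ∂ν :=
          integral_mono_of_nonneg (.of_forall fun _ => abs_nonneg _)
            (((hUi m).const_mul _).fun_add i2) (.of_forall h6)
      _ = |Z⁻¹ - 1| * Z + J := by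
          rw [integral_add ((hUi m).const_mul _) i2, integral_const_mul]
      _ = |Z - 1| + J := by
          congr 1
          have hz : |Z⁻¹ - 1| * Z = |(Z⁻¹ - 1) * Z| := by rw [abs_mul, abs_of_pos hZp]
          rw [hz, sub_mul, inv_mul_cancel₀ hZp.ne', one_mul, abs_sub_comm]
      _ ≤ η := by linarith [hm.1]
end BLM

namespace BLM
open MeasureTheory ProbabilityTheory
open scoped ENNReal NNReal
set_option linter.unusedSectionVars false
set_option linter.unusedVariables false

variable {E : Type*} [NormedAddCommGroup E] [InnerProductSpace ℝ E] [FiniteDimensional ℝ E]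
  [MeasurableSpace E] [BorelSpace E]

lemma wd_prob_of (ν : Measure E) {V : E → ℝ} (hV : Continuous V)
    (hi : Integrable (fun x => Real.exp (-V x)) ν)
    (h1 : ∫ x, Real.exp (-V x) ∂ν = 1) : IsProbabilityMeasure (wd ν V) := by
  constructor
  rw [wd, withDensity_apply _ MeasurableSet.univ, Measure.restrict_univ,
    ← ofReal_integral_eq_lintegral_ofReal hi (.of_forall fun _ => (Real.exp_pos _).le), h1]
  simp

lemma of_prob (ν : Measure E) {V : E → ℝ} (hV : Continuous V) [IsProbabilityMeasure (wd ν V)] :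
    Integrable (fun x => Real.exp (-V x)) ν ∧ ∫ x, Real.exp (-V x) ∂ν = 1 := by
  have h := (wd_integrable (ν := ν) hV (fun _ => (1:ℝ))).1 (integrable_const _)
  have h2 := wd_integral (ν := ν) hV (fun _ => (1:ℝ))
  simp at h h2
  exact ⟨h, h2.symm⟩

lemma wd_close (ν : Measure E) {V ρ : E → ℝ} (hV : Continuous V) (hρ : Continuous ρ)
    [IsProbabilityMeasure (wd ν V)] [IsProbabilityMeasure (wd ν ρ)] {f : E → ℝ}
    (hf : Measurable f) {B η : ℝ} (hB : ∀ x, |f x| ≤ B)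
    (h : ∫ x, |Real.exp (-V x) - Real.exp (-ρ x)| ∂ν ≤ η) :
    |∫ x, f x ∂(wd ν V) - ∫ x, f x ∂(wd ν ρ)| ≤ B * η := by
  have hB0 : 0 ≤ B := (abs_nonneg _).trans (hB 0)
  have i1 : Integrable f (wd ν V) := Integrable.of_bound hf.aestronglyMeasurable B (.of_forall hB)
  have i2 : Integrable f (wd ν ρ) := Integrable.of_bound hf.aestronglyMeasurable B (.of_forall hB)
  rw [wd_integral hV, wd_integral hρ, ← integral_sub ((wd_integrable hV f).1 i1)
    ((wd_integrable hρ f).1 i2)]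
  have i3 : Integrable (fun x => |Real.exp (-V x) - Real.exp (-ρ x)|) ν :=
    ((of_prob ν hV).1.sub (of_prob ν hρ).1).abs
  refine abs_integral_le_integral_abs.trans ?_
  calc _ ≤ ∫ x, B * |Real.exp (-V x) - Real.exp (-ρ x)| ∂ν := by
        refine integral_mono_of_nonneg (.of_forall fun _ => abs_nonneg _) (i3.const_mul B)
          (.of_forall fun x => ?_)
        show |f x * Real.exp (-V x) - f x * Real.exp (-ρ x)| ≤ _
        rw [← mul_sub, abs_mul]
        exact mul_le_mul_of_nonneg_right (hB x) (abs_nonneg _)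
    _ ≤ B * η := by
        rw [integral_const_mul]
        exact mul_le_mul_of_nonneg_left h hB0

lemma wd_close_set (ν : Measure E) {V ρ : E → ℝ} (hV : Continuous V) (hρ : Continuous ρ)
    [IsProbabilityMeasure (wd ν V)] [IsProbabilityMeasure (wd ν ρ)] {S : Set E}
    (hS : MeasurableSet S) {η : ℝ}
    (h : ∫ x, |Real.exp (-V x) - Real.exp (-ρ x)| ∂ν ≤ η) :
    |(wd ν V).real S - (wd ν ρ).real S| ≤ η := by
  have := wd_close ν hV hρ (f := S.indicator (fun _ => (1:ℝ))) (measurable_const.indicator hS)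
    (B := 1) (η := η) (fun x => by by_cases hx : x ∈ S <;> simp [hx]) h
  rw [integral_indicator_const _ hS, integral_indicator_const _ hS] at this
  simpa using this

lemma final (ν : Measure E) [ν.IsAddHaarMeasure] {ρ : E → ℝ} (hd : Differentiable ℝ ρ)
    (hc : ConvexOn ℝ Set.univ ρ) [IsProbabilityMeasure (wd ν ρ)] {R : ℝ} (hR : 0 < R)
    (hyp : ∀ u : E → ℝ, LipschitzWith 1 u → ∃ α : ℝ, ∫ x, |u x - α| ∂(wd ν ρ) < R)
    {S : Set E} (hS : MeasurableSet S) (hne : S.Nonempty) {ε : ℝ} (hε : 0 < ε) (hεR : ε < R)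
    {K : ℝ} (hK0 : 0 < K) (hK : ∀ t, |deriv Real.smoothTransition t| ≤ K) :
    (wd ν ρ).real S * (1 - (wd ν ρ).real S) ≤
      (11 + 10240 * K) * (R / ε) * (wd ν ρ).real (Metric.thickening ε S \ S) := by
  obtain ⟨hi, h1⟩ := of_prob ν hd.continuous
  have hT : MeasurableSet (Metric.thickening ε S \ S) :=
    Metric.isOpen_thickening.measurableSet.diff hS
  set C := (11 + 10240 * K) * (R / ε) with hC
  have hCp : 0 < C := by positivity
  refine le_of_forall_pos_le_add fun κ hκ => ?_
  set η := min (1 / 64) (κ / (C + 1)) with hη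
  have hηp : 0 < η := by positivity
  have hη1 : η ≤ 1 / 64 := min_le_left _ _
  have hη2 : η * (C + 1) ≤ κ := by
    rw [← le_div_iff₀ (by positivity)]; exact min_le_right _ _
  obtain ⟨V, W, L, lam, hlam, hNP, hV1, hVe⟩ := approx ν hd hc hi h1 hηp
  have hVi : Integrable (fun x => Real.exp (-V x)) ν := by
    simpa using hNP.int ν 0
  haveI := wd_prob_of ν hNP.contV hVi hV1
  have hconc : Conc (wd ν V) (64 * R) (2 * R) := by
    intro u hu hu0 hu1
    obtain ⟨α, hα⟩ := hyp u hu
    set β := max 0 (min α (64 * R)) with hβ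
    have hβ0 : 0 ≤ β := le_max_left _ _
    have hβ1 : β ≤ 64 * R := max_le (by positivity) (min_le_right _ _)
    have hum : Measurable u := hu.continuous.measurable
    have hcmp : ∀ x, |u x - β| ≤ |u x - α| := by
      intro x
      have h0 := hu0 x
      have h1 := hu1 x
      have p1 := le_abs_self (u x - α)
      have p2 := neg_abs_le (u x - α)
      rw [hβ, abs_le]
      rcases le_total α (64 * R) with h | h
      · rw [min_eq_left h]
        rcases le_total 0 α with h' | h'
        · rw [max_eq_right h']; constructor <;> linarith
        · rw [max_eq_left h']; constructor <;> linarith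
      · rw [min_eq_right h, max_eq_right (by positivity)]; constructor <;> linarith
    have hbd : ∀ x, |(|u x - β|)| ≤ 64 * R := by
      intro x
      rw [abs_abs, abs_le]
      have h0 := hu0 x
      have h1 := hu1 x
      constructor <;> linarith
    have q1 := wd_close ν hNP.contV hd.continuous (f := fun x => |u x - β|)
      (by fun_prop) hbd hVe
    have q2 : ∫ x, |u x - β| ∂(wd ν ρ) ≤ ∫ x, |u x - α| ∂(wd ν ρ) := by
      refine integral_mono_of_nonneg (.of_forall fun _ => abs_nonneg _) ?_ (.of_forall hcmp)
      refine Integrable.of_bound (by fun_prop) (64 * R + |α|) (.of_forall fun x => ?_)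
      rw [Real.norm_eq_abs, abs_abs]
      refine (abs_sub _ _).trans ?_
      rw [abs_of_nonneg (hu0 x)]
      linarith [hu1 x]
    refine ⟨β, hβ0, hβ1, ?_⟩
    have q3 : 64 * R * η ≤ R := by nlinarith
    have := (abs_le.1 q1).2
    linarith
  have main := iso_nice hK0 hK hNP hlam ν hε hεR hconc hS hne
  rw [← hC] at main
  have e1 := abs_le.1 (wd_close_set ν hNP.contV hd.continuous hS hVe)
  have e2 := abs_le.1 (wd_close_set ν hNP.contV hd.continuous hT hVe)
  have b1 : (wd ν V).real S ≤ 1 := measureReal_le_one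
  have b2 : (wd ν ρ).real S ≤ 1 := measureReal_le_one
  have b3 : 0 ≤ (wd ν V).real S := measureReal_nonneg
  have b4 : 0 ≤ (wd ν ρ).real S := measureReal_nonneg
  generalize (wd ν V).real S = p at *
  generalize (wd ν ρ).real S = q at *
  generalize (wd ν V).real (Metric.thickening ε S \ S) = s at *
  generalize (wd ν ρ).real (Metric.thickening ε S \ S) = t at *
  have f1 : q * (1 - q) - p * (1 - p) ≤ η := by
    have e : q * (1 - q) - p * (1 - p) = (q - p) * (1 - p - q) := by ring
    rw [e]
    refine (le_abs_self _).trans ?_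
    rw [abs_mul]
    have g1 : |q - p| ≤ η := by rw [abs_le]; constructor <;> linarith [e1.1, e1.2]
    have g2 : |1 - p - q| ≤ 1 := by rw [abs_le]; constructor <;> linarith
    nlinarith [abs_nonneg (q - p), abs_nonneg (1 - p - q)]
  have f2 : C * s ≤ C * (t + η) := mul_le_mul_of_nonneg_left (by linarith [e2.2]) hCp.le
  nlinarith
end BLM


/-- **Buser–Ledoux–E. Milman inequality (Euclidean case)**: there is a universal constant
`c > 0` such that for every log-concave probability measure `μ = e^{-ρ}dx` on `ℝⁿ`
(`ρ` smooth and convex, the `CD(0,∞)` condition), if every `1`-Lipschitz function has an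
`L¹(μ)`-distance less than `R` from some constant, then
`μ(S_ε \ S) ≥ c (ε/R) μ(S)(1-μ(S))` for every Borel set `S` and every `0 < ε < R`. -/
theorem buser_ledoux_milman :
    ∃ c : ℝ, 0 < c ∧
      ∀ n : ℕ, 2 ≤ n →
      ∀ ρ : EuclideanSpace ℝ (Fin n) → ℝ, ContDiff ℝ (⊤ : ℕ∞) ρ → ConvexOn ℝ Set.univ ρ →
      ∀ μ : Measure (EuclideanSpace ℝ (Fin n)),
        μ = volume.withDensity (fun x => ENNReal.ofReal (Real.exp (-ρ x))) →
        IsProbabilityMeasure μ →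
      ∀ R : ℝ, 0 < R →
        (∀ u : EuclideanSpace ℝ (Fin n) → ℝ, LipschitzWith 1 u →
          ∃ α : ℝ, ∫ x, |u x - α| ∂μ < R) →
      ∀ S : Set (EuclideanSpace ℝ (Fin n)), MeasurableSet S →
      ∀ ε : ℝ, 0 < ε → ε < R →
        ENNReal.ofReal (c * (ε / R) * (μ S).toReal * (1 - (μ S).toReal)) ≤
          μ (Metric.thickening ε S \ S) := by
  obtain ⟨K, hK0, hK⟩ := BLM.st_bound
  refine ⟨1 / (11 + 10240 * K), by positivity, ?_⟩
  intro n _ ρ hρ hc μ hμ hp R hR hyp S hS ε hε hεR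
  rcases S.eq_empty_or_nonempty with rfl | hne
  · simp
  have hμ' : μ = BLM.wd volume ρ := hμ
  subst hμ'
  have h := BLM.final volume (hρ.differentiable (by simp)) hc hR hyp hS hne hε hεR hK0 hK
  rw [ENNReal.ofReal_le_iff_le_toReal (measure_ne_top _ _)]
  simp only [measureReal_def] at h
  have hA : (0:ℝ) < 11 + 10240 * K := by positivity
  generalize ((BLM.wd volume ρ) S).toReal = p at *
  generalize ((BLM.wd volume ρ) (Metric.thickening ε S \ S)).toReal = t at *
  have h2 := mul_le_mul_of_nonneg_left h (show 0 ≤ 1 / (11 + 10240 * K) * (ε / R) by positivity)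
  have e : 1 / (11 + 10240 * K) * (ε / R) * ((11 + 10240 * K) * (R / ε) * t) = t := by
    field_simp
  rw [e] at h2
  linarith
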